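/- arXiv:2003.03806 — 3 statements merged into one kernel-verified Lean document; each statement's English description precedes it below -/
import Mathlib

section
/- Let (u¹, θ¹) and (u², θ²) be two smooth solutions on [0,T] of the thermoelasticity system u_tt − u_xx = −μ θ_x, θ_t − θ_xx + μ θ u_tx = 0 on [0,T] × [a,b] with u(t,a) = u(t,b) = 0 and θ_x(t,a) = θ_x(t,b) = 0 for all t ∈ [0,T], and with the same initial data: u¹(0,·) = u²(0,·), u¹_t(0,·) = u²_t(0,·) and θ¹(0,·) = θ²(0,·). Then u¹ = u² and θ¹ = θ² on [0,T] × [a,b]. -/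
open Set MeasureTheory

/-- Partial derivative in the first (time) variable. -/
noncomputable def pt (w : ℝ → ℝ → ℝ) (t x : ℝ) : ℝ := deriv (fun s => w s x) t

/-- Partial derivative in the second (space) variable. -/
noncomputable def px (w : ℝ → ℝ → ℝ) (t x : ℝ) : ℝ := deriv (fun y => w t y) x

/-- Square of the L² norm on (a,b). -/
noncomputable def sqInt (a b : ℝ) (f : ℝ → ℝ) : ℝ := ∫ x in a..b, (f x) ^ 2

/-- The L² norm on (a,b). -/
noncomputable def L2norm (a b : ℝ) (f : ℝ → ℝ) : ℝ := Real.sqrt (sqInt a b f)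

/-- A smooth solution of the regularized thermoelasticity system on [0,T] × [a,b]:
`u_tt − u_xx − ν u_txx = −μ θ_x`, `θ_t − θ_xx + μ θ u_tx = 0`,
with Dirichlet boundary conditions for `u` and Neumann boundary conditions for `θ`. -/
def IsRegSolution (a b μ T ν : ℝ) (u θ : ℝ → ℝ → ℝ) : Prop :=
  ContDiff ℝ (⊤ : ℕ∞) (Function.uncurry u) ∧ ContDiff ℝ (⊤ : ℕ∞) (Function.uncurry θ) ∧
  (∀ t ∈ Set.Icc (0:ℝ) T, ∀ x ∈ Set.Icc a b,
      pt (pt u) t x - px (px u) t x - ν * px (px (pt u)) t x = -μ * px θ t x) ∧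
  (∀ t ∈ Set.Icc (0:ℝ) T, ∀ x ∈ Set.Icc a b,
      pt θ t x - px (px θ) t x + μ * θ t x * px (pt u) t x = 0) ∧
  (∀ t ∈ Set.Icc (0:ℝ) T, u t a = 0 ∧ u t b = 0) ∧
  (∀ t ∈ Set.Icc (0:ℝ) T, px θ t a = 0 ∧ px θ t b = 0)

open Function Topology

/-! ### Partial derivatives of smooth functions -/

section PartialDerivatives

variable {w : ℝ → ℝ → ℝ}

theorem hasDerivAt_fst (hw : ContDiff ℝ (⊤ : ℕ∞) (uncurry w)) (t x : ℝ) :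
    HasDerivAt (fun s => w s x) (fderiv ℝ (uncurry w) (t, x) (1, 0)) t := by
  have h := (hw.differentiable (by simp) (t, x)).hasFDerivAt
  exact h.comp_hasDerivAt t ((hasDerivAt_id t).prodMk (hasDerivAt_const t x))

theorem hasDerivAt_snd (hw : ContDiff ℝ (⊤ : ℕ∞) (uncurry w)) (t x : ℝ) :
    HasDerivAt (fun y => w t y) (fderiv ℝ (uncurry w) (t, x) (0, 1)) x := by
  have h := (hw.differentiable (by simp) (t, x)).hasFDerivAt
  exact h.comp_hasDerivAt x ((hasDerivAt_const x t).prodMk (hasDerivAt_id x))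

theorem hasDerivAt_pt (hw : ContDiff ℝ (⊤ : ℕ∞) (uncurry w)) (t x : ℝ) :
    HasDerivAt (fun s => w s x) (pt w t x) t :=
  (hasDerivAt_fst hw t x).differentiableAt.hasDerivAt

theorem hasDerivAt_px (hw : ContDiff ℝ (⊤ : ℕ∞) (uncurry w)) (t x : ℝ) :
    HasDerivAt (fun y => w t y) (px w t x) x :=
  (hasDerivAt_snd hw t x).differentiableAt.hasDerivAt

theorem uncurry_pt (hw : ContDiff ℝ (⊤ : ℕ∞) (uncurry w)) :
    uncurry (pt w) = fun p => fderiv ℝ (uncurry w) p (1, 0) :=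
  funext fun p => (hasDerivAt_fst hw p.1 p.2).deriv

theorem uncurry_px (hw : ContDiff ℝ (⊤ : ℕ∞) (uncurry w)) :
    uncurry (px w) = fun p => fderiv ℝ (uncurry w) p (0, 1) :=
  funext fun p => (hasDerivAt_snd hw p.1 p.2).deriv

theorem contDiff_pt (hw : ContDiff ℝ (⊤ : ℕ∞) (uncurry w)) :
    ContDiff ℝ (⊤ : ℕ∞) (uncurry (pt w)) := by
  rw [uncurry_pt hw]
  exact (hw.fderiv_right (by simp)).clm_apply contDiff_const

theorem contDiff_px (hw : ContDiff ℝ (⊤ : ℕ∞) (uncurry w)) :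
    ContDiff ℝ (⊤ : ℕ∞) (uncurry (px w)) := by
  rw [uncurry_px hw]
  exact (hw.fderiv_right (by simp)).clm_apply contDiff_const

theorem pt_px_comm (hw : ContDiff ℝ (⊤ : ℕ∞) (uncurry w)) (t x : ℝ) :
    pt (px w) t x = px (pt w) t x := by
  have hd : DifferentiableAt ℝ (fderiv ℝ (uncurry w)) (t, x) :=
    (hw.fderiv_right (m := 1) (WithTop.coe_le_coe.2 le_top)).differentiable (by simp) _
  have hsymm : IsSymmSndFDerivAt ℝ (uncurry w) (t, x) :=
    hw.contDiffAt.isSymmSndFDerivAt (by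
      rw [minSmoothness_of_isRCLikeNormedField]
      exact WithTop.coe_le_coe.2 (le_top : (2 : ℕ∞) ≤ ⊤))
  have h₁ : pt (px w) t x = fderiv ℝ (uncurry (px w)) (t, x) (1, 0) :=
    (hasDerivAt_fst (contDiff_px hw) t x).deriv
  have h₂ : px (pt w) t x = fderiv ℝ (uncurry (pt w)) (t, x) (0, 1) :=
    (hasDerivAt_snd (contDiff_pt hw) t x).deriv
  rw [h₁, h₂, uncurry_px hw, uncurry_pt hw, fderiv_clm_apply hd (by fun_prop),
    fderiv_clm_apply hd (by fun_prop)]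
  simpa using hsymm (1, 0) (0, 1)

end PartialDerivatives

/-! ### The energy method -/

/-- Differentiation under the integral sign for integrands with a continuous time derivative. -/
theorem hasDerivAt_integral_of_continuous {a b : ℝ} {e et : ℝ → ℝ → ℝ}
    (he : Continuous (uncurry e)) (het : Continuous (uncurry et))
    (hderiv : ∀ t x, HasDerivAt (fun s => e s x) (et t x) t) (t : ℝ) :
    HasDerivAt (fun s => ∫ x in a..b, e s x) (∫ x in a..b, et t x) t := by
  have hslice (s : ℝ) : Continuous (e s) := he.comp (by fun_prop : Continuous fun x => (s, x))
  obtain ⟨M, hM⟩ := ((isCompact_Icc (a := t - 1) (b := t + 1)).prod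
    (isCompact_uIcc (a := a) (b := b))).exists_bound_of_continuousOn het.continuousOn
  refine (intervalIntegral.hasDerivAt_integral_of_dominated_loc_of_deriv_le
    (bound := fun _ => M) (Icc_mem_nhds (by linarith : t - 1 < t) (by linarith : t < t + 1))
    (.of_forall fun s => (hslice s).aestronglyMeasurable)
    ((hslice t).intervalIntegrable _ _)
    (het.comp (by fun_prop : Continuous fun x => (t, x))).aestronglyMeasurable
    (.of_forall fun x hx s hs => hM (s, x) ⟨hs, uIoc_subset_uIcc hx⟩)
    intervalIntegrable_const (.of_forall fun x _ s _ => hderiv s x)).2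

/-- A nonnegative density `e` with `e_t ≤ F_x + C e`, whose flux `F` vanishes on the lateral
boundary and which vanishes initially, vanishes identically. -/
theorem energy_density_eq_zero {a b T C : ℝ} (hab : a < b) {e et F Fx : ℝ → ℝ → ℝ}
    (he : Continuous (uncurry e)) (het : Continuous (uncurry et)) (hFx : Continuous (uncurry Fx))
    (he_deriv : ∀ t x, HasDerivAt (fun s => e s x) (et t x) t)
    (hF_deriv : ∀ t x, HasDerivAt (fun y => F t y) (Fx t x) x)
    (he_nonneg : ∀ t x, 0 ≤ e t x)
    (hle : ∀ t ∈ Ioo 0 T, ∀ x ∈ Icc a b, et t x ≤ Fx t x + C * e t x)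
    (hFa : ∀ t ∈ Ioo 0 T, F t a = 0) (hFb : ∀ t ∈ Ioo 0 T, F t b = 0)
    (he_zero : ∀ x ∈ Icc a b, e 0 x = 0) :
    ∀ t ∈ Icc 0 T, ∀ x ∈ Icc a b, e t x = 0 := by
  have hslice {f : ℝ → ℝ → ℝ} (hf : Continuous (uncurry f)) (s : ℝ) : Continuous (f s) :=
    hf.comp (by fun_prop : Continuous fun x => (s, x))
  set E : ℝ → ℝ := fun t => ∫ x in a..b, e t x with hE
  have hE_deriv := hasDerivAt_integral_of_continuous (a := a) (b := b) he het he_deriv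
  have hE_le (t : ℝ) (ht : t ∈ Ioo 0 T) : ∫ x in a..b, et t x ≤ C * E t := by
    have hflux : ∫ x in a..b, Fx t x = 0 := by
      rw [intervalIntegral.integral_eq_sub_of_hasDerivAt (fun x _ => hF_deriv t x)
        ((hslice hFx t).intervalIntegrable _ _), hFa t ht, hFb t ht, sub_zero]
    calc ∫ x in a..b, et t x ≤ ∫ x in a..b, (Fx t x + C * e t x) :=
          intervalIntegral.integral_mono_on hab.le ((hslice het t).intervalIntegrable _ _)
            (((hslice hFx t).add ((hslice he t).const_mul C)).intervalIntegrable _ _) (hle t ht)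
      _ = C * E t := by
          rw [intervalIntegral.integral_add ((hslice hFx t).intervalIntegrable _ _)
            (((hslice he t).const_mul C).intervalIntegrable _ _), hflux,
            intervalIntegral.integral_const_mul, zero_add]
  have hG_deriv (t : ℝ) : HasDerivAt (fun s => Real.exp (-C * s) * E s)
      (Real.exp (-C * t) * (-C * 1) * E t + Real.exp (-C * t) * ∫ x in a..b, et t x) t :=
    (((hasDerivAt_id t).const_mul (-C)).exp).mul (hE_deriv t)
  have hanti : AntitoneOn (fun s => Real.exp (-C * s) * E s) (Icc 0 T) := by
    refine antitoneOn_of_deriv_nonpos (convex_Icc 0 T)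
      (fun t _ => (hG_deriv t).continuousAt.continuousWithinAt)
      (fun t _ => (hG_deriv t).differentiableAt.differentiableWithinAt) fun t ht => ?_
    rw [interior_Icc] at ht
    rw [(hG_deriv t).deriv]
    nlinarith [hE_le t ht, Real.exp_pos (-C * t)]
  have hE_zero : E 0 = 0 := by
    rw [hE]
    refine (intervalIntegral.integral_congr (g := fun _ => 0) fun x hx => ?_).trans (by simp)
    exact he_zero x (by rwa [uIcc_of_le hab.le] at hx)
  intro t ht x hx
  by_contra hne
  have hpos : 0 < E t := intervalIntegral.integral_pos hab (hslice he t).continuousOn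
    (fun y _ => he_nonneg t y) ⟨x, hx, (he_nonneg t x).lt_of_ne' hne⟩
  have h := hanti ⟨le_rfl, ht.1.trans ht.2⟩ ht ht.1
  simp only [hE_zero, mul_zero] at h
  exact absurd h (not_le.2 (mul_pos (Real.exp_pos _) hpos))

theorem IsRegSolution.pt_eq_zero_of_mem_Ioo {a b μ T ν : ℝ} {u θ : ℝ → ℝ → ℝ}
    (h : IsRegSolution a b μ T ν u θ) {t : ℝ} (ht : t ∈ Ioo 0 T) :
    pt u t a = 0 ∧ pt u t b = 0 := by
  obtain ⟨-, -, -, -, hbdry, -⟩ := h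
  have hmem : ∀ᶠ s in 𝓝 t, s ∈ Icc 0 T := Icc_mem_nhds ht.1 ht.2
  constructor
  · exact (Filter.EventuallyEq.deriv_eq (hmem.mono fun s hs => (hbdry s hs).1)).trans
      (deriv_const t (0 : ℝ))
  · exact (Filter.EventuallyEq.deriv_eq (hmem.mono fun s hs => (hbdry s hs).2)).trans
      (deriv_const t (0 : ℝ))

/-- The pointwise bound on the lower-order terms in the energy identity for the difference of two
solutions: `v` and `φ` stand for the differences of velocities and temperatures, `φx` for the space
derivative of the latter, and `p`, `q`, `r` for the bounded coefficients. -/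
theorem energy_remainder_le {μ M v z φ φx p q r : ℝ} (hμ : 0 < μ) (hp : |p| ≤ M) (hq : |q| ≤ M)
    (hr : |r| ≤ M) :
    -2 * φx ^ 2 + 2 * μ * (p - 1) * v * φx + 2 * μ * q * φ * v - 2 * μ * φ ^ 2 * r ≤
      (μ ^ 2 * (M + 1) ^ 2 + 3 * μ * M) * (v ^ 2 + z ^ 2 + φ ^ 2) := by
  have hM : 0 ≤ M := (abs_nonneg p).trans hp
  have hp₁ : (p - 1) ^ 2 ≤ (M + 1) ^ 2 := by
    rw [abs_le] at hp
    nlinarith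
  have h₁ : -2 * φx ^ 2 + 2 * μ * (p - 1) * v * φx ≤ μ ^ 2 * (M + 1) ^ 2 * v ^ 2 := by
    have : μ ^ 2 * (p - 1) ^ 2 * v ^ 2 ≤ μ ^ 2 * (M + 1) ^ 2 * v ^ 2 := by gcongr
    nlinarith [sq_nonneg (φx - μ * (p - 1) * v), sq_nonneg φx]
  have h₂ : 2 * q * φ * v ≤ M * (φ ^ 2 + v ^ 2) := by
    rw [abs_le] at hq
    nlinarith [mul_nonneg (sub_nonneg.2 hq.2) (sq_nonneg (φ - v)),
      mul_nonneg (by linarith [hq.1] : 0 ≤ M + q) (sq_nonneg (φ - v)),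
      mul_nonneg (sub_nonneg.2 hq.2) (sq_nonneg (φ + v)),
      mul_nonneg (by linarith [hq.1] : 0 ≤ M + q) (sq_nonneg (φ + v))]
  have h₃ : -(2 * φ ^ 2 * r) ≤ 2 * M * φ ^ 2 := by
    nlinarith [mul_nonneg (by linarith [(abs_le.1 hr).1] : 0 ≤ M + r) (sq_nonneg φ)]
  have h₄ := mul_le_mul_of_nonneg_left (add_le_add h₂ h₃) hμ.le
  have h₅ : 0 ≤ μ * M := mul_nonneg hμ.le hM
  have h₆ : 0 ≤ μ ^ 2 * (M + 1) ^ 2 := by positivity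
  nlinarith [mul_nonneg h₅ (sq_nonneg v), mul_nonneg h₅ (sq_nonneg z),
    mul_nonneg h₆ (sq_nonneg z), mul_nonneg h₆ (sq_nonneg φ)]

/-- **Uniqueness for the thermoelasticity system** (`ν = 0`): two smooth solutions of
`u_tt − u_xx = −μ θ_x`, `θ_t − θ_xx + μ θ u_tx = 0` with the same initial data coincide
on `[0,T] × [a,b]`. -/
theorem uniqueness_thermoelasticity (a b μ T : ℝ) (hab : a < b) (hμ : 0 < μ) (hT : 0 < T)
    (u₁ θ₁ u₂ θ₂ : ℝ → ℝ → ℝ)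
    (hsol₁ : IsRegSolution a b μ T 0 u₁ θ₁) (hsol₂ : IsRegSolution a b μ T 0 u₂ θ₂)
    (hu0 : ∀ x ∈ Icc a b, u₁ 0 x = u₂ 0 x)
    (hu1 : ∀ x ∈ Icc a b, pt u₁ 0 x = pt u₂ 0 x)
    (hθ0 : ∀ x ∈ Icc a b, θ₁ 0 x = θ₂ 0 x) :
    ∀ t ∈ Icc (0:ℝ) T, ∀ x ∈ Icc a b, u₁ t x = u₂ t x ∧ θ₁ t x = θ₂ t x := by
  obtain ⟨hu₁, hθ₁, hwave₁, hheat₁, -, hneu₁⟩ := id hsol₁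
  obtain ⟨hu₂, hθ₂, hwave₂, hheat₂, -, hneu₂⟩ := id hsol₂
  obtain ⟨A, hA⟩ := ((isCompact_Icc (a := (0 : ℝ)) (b := T)).prod
    (isCompact_Icc (a := a) (b := b))).exists_bound_of_continuousOn hθ₁.continuous.continuousOn
  obtain ⟨B, hB⟩ := ((isCompact_Icc (a := (0 : ℝ)) (b := T)).prod
    (isCompact_Icc (a := a) (b := b))).exists_bound_of_continuousOn
      (contDiff_px hθ₁).continuous.continuousOn
  obtain ⟨D, hD⟩ := ((isCompact_Icc (a := (0 : ℝ)) (b := T)).prod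
    (isCompact_Icc (a := a) (b := b))).exists_bound_of_continuousOn
      (contDiff_px (contDiff_pt hu₂)).continuous.continuousOn
  set M := max A (max B D)
  set w : ℝ → ℝ → ℝ := fun t x => u₁ t x - u₂ t x with hw_def
  set φ : ℝ → ℝ → ℝ := fun t x => θ₁ t x - θ₂ t x with hφ_def
  have hw : ContDiff ℝ (⊤ : ℕ∞) (uncurry w) := hu₁.sub hu₂
  have hφ : ContDiff ℝ (⊤ : ℕ∞) (uncurry φ) := hθ₁.sub hθ₂
  have pt_sub {f g : ℝ → ℝ → ℝ} (hf : ContDiff ℝ (⊤ : ℕ∞) (uncurry f))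
      (hg : ContDiff ℝ (⊤ : ℕ∞) (uncurry g)) :
      pt (fun t x => f t x - g t x) = fun t x => pt f t x - pt g t x :=
    funext₂ fun t x => ((hasDerivAt_pt hf t x).sub (hasDerivAt_pt hg t x)).deriv
  have px_sub {f g : ℝ → ℝ → ℝ} (hf : ContDiff ℝ (⊤ : ℕ∞) (uncurry f))
      (hg : ContDiff ℝ (⊤ : ℕ∞) (uncurry g)) :
      px (fun t x => f t x - g t x) = fun t x => px f t x - px g t x :=
    funext₂ fun t x => ((hasDerivAt_px hf t x).sub (hasDerivAt_px hg t x)).deriv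
  have hwt : pt w = fun t x => pt u₁ t x - pt u₂ t x := pt_sub hu₁ hu₂
  have hwx : px w = fun t x => px u₁ t x - px u₂ t x := px_sub hu₁ hu₂
  have hwtt : pt (pt w) = fun t x => pt (pt u₁) t x - pt (pt u₂) t x := by
    rw [hwt, pt_sub (contDiff_pt hu₁) (contDiff_pt hu₂)]
  have hwxx : px (px w) = fun t x => px (px u₁) t x - px (px u₂) t x := by
    rw [hwx, px_sub (contDiff_px hu₁) (contDiff_px hu₂)]
  have hwtx : px (pt w) = fun t x => px (pt u₁) t x - px (pt u₂) t x := by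
    rw [hwt, px_sub (contDiff_pt hu₁) (contDiff_pt hu₂)]
  have hφt : pt φ = fun t x => pt θ₁ t x - pt θ₂ t x := pt_sub hθ₁ hθ₂
  have hφx : px φ = fun t x => px θ₁ t x - px θ₂ t x := px_sub hθ₁ hθ₂
  have hφxx : px (px φ) = fun t x => px (px θ₁) t x - px (px θ₂) t x := by
    rw [hφx, px_sub (contDiff_px hθ₁) (contDiff_px hθ₂)]
  have hwave (t) (ht : t ∈ Icc 0 T) (x) (hx : x ∈ Icc a b) :
      pt (pt w) t x = px (px w) t x - μ * px φ t x := by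
    rw [hwtt, hwxx, hφx]
    linarith [hwave₁ t ht x hx, hwave₂ t ht x hx]
  have hheat (t) (ht : t ∈ Icc 0 T) (x) (hx : x ∈ Icc a b) :
      pt φ t x = px (px φ) t x - μ * θ₁ t x * px (pt w) t x - μ * φ t x * px (pt u₂) t x := by
    rw [hφt, hφxx, hwtx, hφ_def]
    linarith [hheat₁ t ht x hx, hheat₂ t ht x hx]
  have cφ := hφ.continuous
  have cθ₁ := hθ₁.continuous
  have cθ₁x := (contDiff_px hθ₁).continuous
  have cwt := (contDiff_pt hw).continuous
  have cwx := (contDiff_px hw).continuous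
  have cwtt := (contDiff_pt (contDiff_pt hw)).continuous
  have cwxx := (contDiff_px (contDiff_px hw)).continuous
  have cwtx := (contDiff_px (contDiff_pt hw)).continuous
  have cφt := (contDiff_pt hφ).continuous
  have cφx := (contDiff_px hφ).continuous
  have cφxx := (contDiff_px (contDiff_px hφ)).continuous
  have hwt_bdry (t) (ht : t ∈ Ioo 0 T) : pt w t a = 0 ∧ pt w t b = 0 := by
    simp [hwt, hsol₁.pt_eq_zero_of_mem_Ioo ht, hsol₂.pt_eq_zero_of_mem_Ioo ht]
  have hφx_bdry (t) (ht : t ∈ Ioo 0 T) : px φ t a = 0 ∧ px φ t b = 0 := by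
    have ht' := Ioo_subset_Icc_self ht
    simp [hφx, hneu₁ t ht', hneu₂ t ht']
  have hzero := energy_density_eq_zero (T := T) (C := μ ^ 2 * (M + 1) ^ 2 + 3 * μ * M) hab
    (e := fun t x => pt w t x ^ 2 + px w t x ^ 2 + φ t x ^ 2)
    (et := fun t x => 2 * (pt w t x * pt (pt w) t x + px w t x * px (pt w) t x
      + φ t x * pt φ t x))
    (F := fun t x => 2 * (pt w t x * px w t x + φ t x * px φ t x
      - μ * (θ₁ t x * φ t x * pt w t x)))
    (Fx := fun t x => 2 * (px (pt w) t x * px w t x + pt w t x * px (px w) t x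
      + (px φ t x * px φ t x + φ t x * px (px φ) t x)
      - μ * ((px θ₁ t x * φ t x + θ₁ t x * px φ t x) * pt w t x
        + θ₁ t x * φ t x * px (pt w) t x)))
    (by exact ((cwt.pow 2).add (cwx.pow 2)).add (cφ.pow 2))
    ((((cwt.mul cwtt).add (cwx.mul cwtx)).add (cφ.mul cφt)).const_mul 2)
    (((((cwtx.mul cwx).add (cwt.mul cwxx)).add ((cφx.mul cφx).add (cφ.mul cφxx))).sub
      (((((cθ₁x.mul cφ).add (cθ₁.mul cφx)).mul cwt).add
        ((cθ₁.mul cφ).mul cwtx)).const_mul μ)).const_mul 2)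
    (fun t x => by
      have h := (((hasDerivAt_pt (contDiff_pt hw) t x).pow 2).add
        ((hasDerivAt_pt (contDiff_px hw) t x).pow 2)).add ((hasDerivAt_pt hφ t x).pow 2)
      refine h.congr_deriv ?_
      rw [pt_px_comm hw]
      push_cast
      ring)
    (fun t x => ((((hasDerivAt_px (contDiff_pt hw) t x).mul
        (hasDerivAt_px (contDiff_px hw) t x)).add ((hasDerivAt_px hφ t x).mul
        (hasDerivAt_px (contDiff_px hφ) t x))).sub ((((hasDerivAt_px hθ₁ t x).mul
        (hasDerivAt_px hφ t x)).mul (hasDerivAt_px (contDiff_pt hw) t x)).const_mul μ)).const_mul 2)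
    (fun t x => by positivity)
    (fun t ht x hx => by
      have ht' := Ioo_subset_Icc_self ht
      have hp : |θ₁ t x| ≤ M := (hA (t, x) ⟨ht', hx⟩).trans (le_max_left _ _)
      have hq : |px θ₁ t x| ≤ M := (hB (t, x) ⟨ht', hx⟩).trans (by simp [M])
      have hr : |px (pt u₂) t x| ≤ M := (hD (t, x) ⟨ht', hx⟩).trans (by simp [M])
      have h := energy_remainder_le (v := pt w t x) (z := px w t x) (φ := φ t x)
        (φx := px φ t x) hμ hp hq hr
      rw [hwave t ht' x hx, hheat t ht' x hx]
      linarith)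
    (fun t ht => by simp [hwt_bdry t ht, hφx_bdry t ht])
    (fun t ht => by simp [hwt_bdry t ht, hφx_bdry t ht])
    ?_
  · have hwt_zero (t) (ht : t ∈ Icc 0 T) (x) (hx : x ∈ Icc a b) : pt w t x = 0 := by
      have h := hzero t ht x hx
      nlinarith [sq_nonneg (pt w t x), sq_nonneg (px w t x), sq_nonneg (φ t x)]
    intro t ht x hx
    constructor
    · have hconst := constant_of_has_deriv_right_zero (f := fun s => w s x) (a := 0) (b := T)
        (fun s _ => (hasDerivAt_pt hw s x).continuousAt.continuousWithinAt)
        (fun s hs => by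
          simpa [hwt_zero s (Ico_subset_Icc_self hs) x hx] using
            (hasDerivAt_pt hw s x).hasDerivWithinAt) t ht
      simp only [hw_def, hu0 x hx, sub_self] at hconst
      exact sub_eq_zero.1 hconst
    · have h := hzero t ht x hx
      have : φ t x = 0 := by
        nlinarith [sq_nonneg (pt w t x), sq_nonneg (px w t x), sq_nonneg (φ t x)]
      exact sub_eq_zero.1 this
  · intro x hx
    have hwx_zero : px w 0 x = 0 :=
      (uniqueDiffOn_Icc hab x hx).eq_deriv _ (hasDerivAt_px hw 0 x).hasDerivWithinAt
        ((hasDerivWithinAt_const x (Icc a b) (0 : ℝ)).congr_of_mem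
          (fun y hy => sub_eq_zero.2 (hu0 y hy)) hx)
    simp [hwx_zero, hwt, hφ_def, hu1 x hx, hθ0 x hx]
end

section
/- For all a < b, μ > 0, ν > 0, T > 0 and R > 0 there exists a constant C > 0, depending only on a, b, μ, ν, T and R, with the following property: for every smooth solution (u, θ) of the regularized thermoelasticity system on [0,T] with θ ≥ 0 whose initial data satisfy ∫_a^b ( u₀² + (u₀)_x² + (u₀)_xx² ) ≤ R, ∫_a^b ( u₁² + (u₁)_x² + (u₁)_xx² ) ≤ R and ∫_a^b ( θ₀² + (θ₀)_x² + (θ₀)_xx² + (θ₀)_xxx² ) ≤ R, one has sup_{t ∈ [0,T]} ‖θ_tx(t)‖_{L²} ≤ C. -/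
open Set MeasureTheory

/-- Smoothness of a function of time and space as a function on the plane. -/
def SmoothPlane (w : ℝ → ℝ → ℝ) : Prop := ContDiff ℝ (⊤ : ℕ∞) (Function.uncurry w)

namespace SmoothPlane

variable {w z : ℝ → ℝ → ℝ}

theorem differentiable (hw : SmoothPlane w) : Differentiable ℝ (Function.uncurry w) :=
  ContDiff.differentiable hw (by simp)

theorem hasDerivAt_fst (hw : SmoothPlane w) (t x : ℝ) :
    HasDerivAt (fun s => w s x) (fderiv ℝ (Function.uncurry w) (t, x) (1, 0)) t := by
  have hp : HasDerivAt (fun s : ℝ => (s, x)) ((1 : ℝ), (0 : ℝ)) t :=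
    (hasDerivAt_id t).prodMk (hasDerivAt_const t x)
  exact (hw.differentiable (t, x)).hasFDerivAt.comp_hasDerivAt t hp

theorem hasDerivAt_snd (hw : SmoothPlane w) (t x : ℝ) :
    HasDerivAt (fun y => w t y) (fderiv ℝ (Function.uncurry w) (t, x) (0, 1)) x := by
  have hp : HasDerivAt (fun y : ℝ => (t, y)) ((0 : ℝ), (1 : ℝ)) x :=
    (hasDerivAt_const x t).prodMk (hasDerivAt_id x)
  exact (hw.differentiable (t, x)).hasFDerivAt.comp_hasDerivAt x hp

theorem uncurry_pt (hw : SmoothPlane w) :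
    Function.uncurry (pt w) = fun p => fderiv ℝ (Function.uncurry w) p (1, 0) := by
  ext ⟨t, x⟩
  exact (hw.hasDerivAt_fst t x).deriv

theorem uncurry_px (hw : SmoothPlane w) :
    Function.uncurry (px w) = fun p => fderiv ℝ (Function.uncurry w) p (0, 1) := by
  ext ⟨t, x⟩
  exact (hw.hasDerivAt_snd t x).deriv

theorem fderiv_contDiff (hw : SmoothPlane w) :
    ContDiff ℝ (⊤ : ℕ∞) (fderiv ℝ (Function.uncurry w)) :=
  ContDiff.fderiv_right hw (by simp)

protected theorem pt (hw : SmoothPlane w) : SmoothPlane (pt w) := by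
  unfold SmoothPlane
  rw [hw.uncurry_pt]
  exact hw.fderiv_contDiff.clm_apply contDiff_const

protected theorem px (hw : SmoothPlane w) : SmoothPlane (px w) := by
  unfold SmoothPlane
  rw [hw.uncurry_px]
  exact hw.fderiv_contDiff.clm_apply contDiff_const

theorem hasDerivAt_pt (hw : SmoothPlane w) (t x : ℝ) :
    HasDerivAt (fun s => w s x) (_root_.pt w t x) t :=
  (hw.hasDerivAt_fst t x).differentiableAt.hasDerivAt

theorem hasDerivAt_px (hw : SmoothPlane w) (t x : ℝ) :
    HasDerivAt (w t) (_root_.px w t x) x :=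
  (hw.hasDerivAt_snd t x).differentiableAt.hasDerivAt

theorem pt_px (hw : SmoothPlane w) : _root_.pt (_root_.px w) = _root_.px (_root_.pt w) := by
  ext t x
  have hd : DifferentiableAt ℝ (fderiv ℝ (Function.uncurry w)) (t, x) :=
    hw.fderiv_contDiff.differentiable (by simp) (t, x)
  have hsymm : IsSymmSndFDerivAt ℝ (Function.uncurry w) (t, x) :=
    (ContDiff.contDiffAt hw).isSymmSndFDerivAt (by
      rw [minSmoothness_of_isRCLikeNormedField]
      exact WithTop.coe_le_coe.2 (le_top : (2 : ℕ∞) ≤ ⊤))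
  have h₁ := congrFun hw.px.uncurry_pt (t, x)
  have h₂ := congrFun hw.pt.uncurry_px (t, x)
  simp only [Function.uncurry_apply_pair] at h₁ h₂
  rw [h₁, h₂, hw.uncurry_px, hw.uncurry_pt, fderiv_clm_apply hd (differentiableAt_const _),
    fderiv_clm_apply hd (differentiableAt_const _)]
  simpa using hsymm.eq (1, 0) (0, 1)

protected theorem mul (hw : SmoothPlane w) (hz : SmoothPlane z) :
    SmoothPlane (fun t x => w t x * z t x) :=
  ContDiff.mul hw hz

protected theorem continuous (hw : SmoothPlane w) : Continuous (Function.uncurry w) :=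
  ContDiff.continuous hw

theorem continuous_slice (hw : SmoothPlane w) (t : ℝ) : Continuous (w t) :=
  hw.continuous.comp (Continuous.prodMk_right t)

/-- Differentiation under the integral sign for smooth functions on the plane. -/
theorem hasDerivAt_integral (hw : SmoothPlane w) (a b t : ℝ) :
    HasDerivAt (fun s => ∫ x in a..b, w s x) (∫ x in a..b, _root_.pt w t x) t := by
  have hK : IsCompact (Icc (t - 1) (t + 1) ×ˢ uIcc a b) := isCompact_Icc.prod isCompact_uIcc
  obtain ⟨M, hM⟩ := hK.exists_bound_of_continuousOn hw.pt.continuous.continuousOn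
  refine (intervalIntegral.hasDerivAt_integral_of_dominated_loc_of_deriv_le
    (bound := fun _ => M) (s := Icc (t - 1) (t + 1)) (Icc_mem_nhds (by linarith) (by linarith))
    (.of_forall fun s => (hw.continuous_slice s).aestronglyMeasurable)
    ((hw.continuous_slice t).intervalIntegrable _ _)
    (hw.pt.continuous_slice t).aestronglyMeasurable
    (.of_forall fun x hx s hs => hM (s, x) ⟨hs, uIoc_subset_uIcc hx⟩)
    intervalIntegrable_const
    (.of_forall fun x _ s _ => hw.hasDerivAt_pt s x)).2

theorem hasDerivAt_sqInt (hw : SmoothPlane w) (a b t : ℝ) :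
    HasDerivAt (fun s => sqInt a b (w s)) (2 * ∫ x in a..b, w t x * _root_.pt w t x) t := by
  have h := (hw.mul hw).hasDerivAt_integral a b t
  have hpt : ∀ x, _root_.pt (fun t x => w t x * w t x) t x = 2 * (w t x * _root_.pt w t x) := by
    intro x
    refine ((hw.hasDerivAt_pt t x).mul (hw.hasDerivAt_pt t x)).deriv.trans ?_
    ring
  simp only [hpt, intervalIntegral.integral_const_mul] at h
  simpa only [sqInt, pow_two] using h

theorem continuous_sqInt (hw : SmoothPlane w) (a b : ℝ) :
    Continuous (fun s => sqInt a b (w s)) :=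
  continuous_iff_continuousAt.2 fun t => (hw.hasDerivAt_sqInt a b t).continuousAt

/-- Integration by parts in space when the boundary terms vanish. -/
theorem integral_mul_px (hw : SmoothPlane w) (hz : SmoothPlane z) {a b t : ℝ}
    (ha : w t a * z t a = 0) (hb : w t b * z t b = 0) :
    ∫ x in a..b, w t x * _root_.px z t x = -∫ x in a..b, _root_.px w t x * z t x := by
  rw [intervalIntegral.integral_mul_deriv_eq_deriv_mul (fun x _ => hw.hasDerivAt_px t x)
    (fun x _ => hz.hasDerivAt_px t x) ((hw.px.continuous_slice t).intervalIntegrable _ _)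
    ((hz.px.continuous_slice t).intervalIntegrable _ _), ha, hb]
  ring

end SmoothPlane

theorem sqInt_nonneg {a b : ℝ} (hab : a ≤ b) (f : ℝ → ℝ) : 0 ≤ sqInt a b f :=
  intervalIntegral.integral_nonneg hab fun _ _ => sq_nonneg _

/-- Monotonicity of the integral against a linear combination of three functions. -/
theorem integral_le_linear_combination {a b : ℝ} (hab : a ≤ b) {f g₁ g₂ g₃ : ℝ → ℝ}
    (hf : Continuous f) (h₁ : Continuous g₁) (h₂ : Continuous g₂) (h₃ : Continuous g₃)
    (c₁ c₂ c₃ : ℝ) (h : ∀ x ∈ Icc a b, f x ≤ c₁ * g₁ x + c₂ * g₂ x + c₃ * g₃ x) :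
    ∫ x in a..b, f x ≤
      c₁ * (∫ x in a..b, g₁ x) + c₂ * (∫ x in a..b, g₂ x) + c₃ * ∫ x in a..b, g₃ x := by
  have hc : ∀ {g : ℝ → ℝ}, Continuous g → IntervalIntegrable g volume a b :=
    fun hg => hg.intervalIntegrable _ _
  have hmono := intervalIntegral.integral_mono_on (μ := volume) hab (hc hf)
    (hc (g := fun x => c₁ * g₁ x + c₂ * g₂ x + c₃ * g₃ x) (by fun_prop)) h
  rwa [intervalIntegral.integral_add (hc (by fun_prop)) (hc (by fun_prop)),
    intervalIntegral.integral_add (hc (by fun_prop)) (hc (by fun_prop)),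
    intervalIntegral.integral_const_mul, intervalIntegral.integral_const_mul,
    intervalIntegral.integral_const_mul] at hmono

/-- The one-dimensional Sobolev embedding `H¹ ⊆ L^∞` with an explicit constant. -/
theorem sq_le_sqInt_add_sqInt {a b : ℝ} (hab : a < b) {f f' : ℝ → ℝ}
    (hf : ∀ x, HasDerivAt f (f' x) x) (hf' : Continuous f') {x : ℝ} (hx : x ∈ Icc a b) :
    f x ^ 2 ≤ (1 / (b - a) + 1) * (sqInt a b f + sqInt a b f') := by
  have hfc : Continuous f := continuous_iff_continuousAt.2 fun y => (hf y).continuousAt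
  have hba : 0 < b - a := sub_pos.2 hab
  have hsum : ∫ z in a..b, (f z ^ 2 + f' z ^ 2) = sqInt a b f + sqInt a b f' :=
    intervalIntegral.integral_add ((hfc.pow 2).intervalIntegrable _ _)
      ((hf'.pow 2).intervalIntegrable _ _)
  set S := sqInt a b f + sqInt a b f' with hS
  have hdiff : ∀ y ∈ Icc a b, f x ^ 2 ≤ f y ^ 2 + S := by
    intro y hy
    have hftc : ∫ z in y..x, 2 * (f z * f' z) = f x ^ 2 - f y ^ 2 := by
      apply intervalIntegral.integral_eq_sub_of_hasDerivAt
      · intro z _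
        exact ((hf z).fun_pow 2).congr_deriv (by push_cast; ring)
      · exact Continuous.intervalIntegrable (by fun_prop) _ _
    have hle : |∫ z in y..x, 2 * (f z * f' z)| ≤ |∫ z in y..x, (f z ^ 2 + f' z ^ 2)| := by
      have := intervalIntegral.norm_integral_le_abs_of_norm_le (a := y) (b := x)
        (μ := volume) (f := fun z => 2 * (f z * f' z)) (g := fun z => f z ^ 2 + f' z ^ 2)
        (.of_forall fun z => by
          rw [Real.norm_eq_abs, abs_le]
          constructor <;> nlinarith [sq_nonneg (f z + f' z), sq_nonneg (f z - f' z)])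
        (Continuous.intervalIntegrable (by fun_prop) _ _)
      simpa using this
    have hmono : |∫ z in y..x, (f z ^ 2 + f' z ^ 2)| ≤ |∫ z in a..b, (f z ^ 2 + f' z ^ 2)| := by
      apply intervalIntegral.abs_integral_mono_interval
      · rw [uIoc_of_le hab.le]
        intro z hz
        rw [uIoc, mem_Ioc] at hz
        exact ⟨(le_min hy.1 hx.1).trans_lt hz.1, hz.2.trans (max_le hy.2 hx.2)⟩
      · exact .of_forall fun z => by positivity
      · exact Continuous.intervalIntegrable (by fun_prop) _ _
    rw [hsum, abs_of_nonneg (add_nonneg (sqInt_nonneg hab.le f) (sqInt_nonneg hab.le f'))] at hmono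
    have := (le_abs_self _).trans (hle.trans hmono)
    linarith [hftc]
  have hInt := intervalIntegral.integral_mono_on (μ := volume) hab.le
    (f := fun _ => f x ^ 2) (g := fun y => f y ^ 2 + S) intervalIntegrable_const
    (Continuous.intervalIntegrable (by fun_prop) _ _) hdiff
  rw [intervalIntegral.integral_add (f := fun y => f y ^ 2)
      (Continuous.intervalIntegrable (by fun_prop) _ _) intervalIntegrable_const,
    intervalIntegral.integral_const, intervalIntegral.integral_const, smul_eq_mul,
    smul_eq_mul] at hInt
  change _ ≤ sqInt a b f + _ at hInt
  have hf'0 := sqInt_nonneg hab.le f'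
  have hkey : (b - a) * f x ^ 2 ≤ (b - a) * ((1 / (b - a) + 1) * S) := by
    have : (b - a) * ((1 / (b - a) + 1) * S) = S + (b - a) * S := by
      field_simp
    linarith
  exact le_of_mul_le_mul_left hkey hba

/-- A Grönwall estimate controlling both an energy and its dissipation. -/
theorem exists_energy_bound (T A P E₀ : ℝ) (hT : 0 < T) (hA : 0 ≤ A) (hP : 0 ≤ P)
    (hE₀ : 0 ≤ E₀) :
    ∃ B > (0 : ℝ), ∀ E E' D q : ℝ → ℝ, (∀ t, HasDerivAt E (E' t) t) → Continuous D →
      Continuous q → (∀ t ∈ Icc 0 T, 0 ≤ E t) → (∀ t ∈ Icc 0 T, 0 ≤ D t) →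
      (∀ t ∈ Icc 0 T, 0 ≤ q t) → E 0 ≤ E₀ → ∫ t in (0 : ℝ)..T, q t ≤ P →
      (∀ t ∈ Ioo 0 T, E' t + D t ≤ A * (1 + q t) * (1 + E t)) →
      (∀ t ∈ Icc 0 T, E t ≤ B) ∧ ∫ t in (0 : ℝ)..T, D t ≤ B := by
  set M := (1 + E₀) * Real.exp (A * (T + P)) with hM
  have hM0 : 0 < M := by positivity
  refine ⟨M + A * (T + P) * M + E₀, by positivity, ?_⟩
  intro E E' D q hE hD hq hE0 hD0 hq0 hinit hqP hineq
  have hEc : Continuous E := continuous_iff_continuousAt.2 fun t => (hE t).continuousAt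
  set G : ℝ → ℝ := fun t => ∫ s in (0 : ℝ)..t, A * (1 + q s) with hG
  have hgc : Continuous fun s => A * (1 + q s) := by fun_prop
  have hGd : ∀ t, HasDerivAt G (A * (1 + q t)) t := fun t =>
    intervalIntegral.integral_hasDerivAt_right (hgc.intervalIntegrable _ _)
      (hgc.stronglyMeasurableAtFilter _ _) hgc.continuousAt
  have hGT : G T ≤ A * (T + P) := by
    have : G T = A * (T + ∫ t in (0 : ℝ)..T, q t) := by
      rw [hG]
      dsimp only
      rw [intervalIntegral.integral_const_mul, intervalIntegral.integral_add
        intervalIntegrable_const (hq.intervalIntegrable _ _)]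
      simp
    rw [this]
    gcongr
  have hGmono : MonotoneOn G (Icc 0 T) := by
    apply monotoneOn_of_deriv_nonneg (convex_Icc 0 T)
      (fun t _ => (hGd t).continuousAt.continuousWithinAt)
      (fun t _ => (hGd t).differentiableAt.differentiableWithinAt)
    intro t ht
    rw [interior_Icc] at ht
    have := hq0 t (Ioo_subset_Icc_self ht)
    rw [(hGd t).deriv]
    positivity
  have hFd : ∀ t, HasDerivAt (fun s => (1 + E s) * Real.exp (-G s))
      (E' t * Real.exp (-G t) + (1 + E t) * (Real.exp (-G t) * -(A * (1 + q t)))) t := fun t =>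
    ((hE t).const_add 1).mul (hGd t).neg.exp
  have hFanti : AntitoneOn (fun s => (1 + E s) * Real.exp (-G s)) (Icc 0 T) := by
    apply antitoneOn_of_deriv_nonpos (convex_Icc 0 T)
      (fun t _ => (hFd t).continuousAt.continuousWithinAt)
      (fun t _ => (hFd t).differentiableAt.differentiableWithinAt)
    intro t ht
    rw [interior_Icc] at ht
    rw [(hFd t).deriv]
    have h₁ := hineq t ht
    have h₂ := hD0 t (Ioo_subset_Icc_self ht)
    have h₃ : E' t - A * (1 + q t) * (1 + E t) ≤ 0 := by linarith
    have h₄ := mul_nonpos_of_nonneg_of_nonpos (Real.exp_pos (-G t)).le h₃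
    linarith
  have hbound : ∀ t ∈ Icc 0 T, 1 + E t ≤ M := by
    intro t ht
    have h₀ : (0 : ℝ) ∈ Icc 0 T := ⟨le_rfl, hT.le⟩
    have h₁ := hFanti h₀ ht ht.1
    have hG0 : G 0 = 0 := by simp [hG]
    simp only [hG0, neg_zero, Real.exp_zero, mul_one] at h₁
    have h₂ : G t ≤ A * (T + P) := (hGmono ht ⟨hT.le, le_rfl⟩ ht.2).trans hGT
    calc 1 + E t = ((1 + E t) * Real.exp (-G t)) * Real.exp (G t) := by
          rw [mul_assoc, ← Real.exp_add]; simp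
      _ ≤ (1 + E₀) * Real.exp (A * (T + P)) := by
          gcongr
          exact h₁.trans (by linarith)
  have hAM : 0 ≤ A * (T + P) * M := by positivity
  refine ⟨fun t ht => by linarith [hbound t ht], ?_⟩
  have hInt := intervalIntegral.sub_le_integral_of_hasDeriv_right_of_le hT.le hEc.continuousOn
    (fun t _ => (hE t).hasDerivWithinAt) (φ := fun t => M * (A * (1 + q t)) - D t)
    (Continuous.integrableOn_Icc (by fun_prop)) (fun t ht => by
      have h₁ := hineq t ht
      have ht' := Ioo_subset_Icc_self ht
      have h₂ := hq0 t ht'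
      have h₃ := mul_le_mul_of_nonneg_left (hbound t ht')
        (show 0 ≤ A * (1 + q t) by positivity)
      linarith)
  rw [intervalIntegral.integral_sub (Continuous.intervalIntegrable (by fun_prop) _ _)
    (hD.intervalIntegrable _ _), intervalIntegral.integral_const_mul] at hInt
  have h₁ : M * G T ≤ M * (A * (T + P)) := mul_le_mul_of_nonneg_left hGT hM0.le
  have h₂ := hE0 T ⟨hT.le, le_rfl⟩
  change _ ≤ M * G T - _ at hInt
  linarith

theorem SmoothPlane.sq_le_sqInt_add_sqInt {w : ℝ → ℝ → ℝ} (hw : SmoothPlane w) {a b : ℝ}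
    (hab : a < b) (t : ℝ) {x : ℝ} (hx : x ∈ Icc a b) :
    w t x ^ 2 ≤ (1 / (b - a) + 1) * (sqInt a b (w t) + sqInt a b (px w t)) :=
  _root_.sq_le_sqInt_add_sqInt hab (hw.hasDerivAt_px t) (hw.px.continuous_slice t) hx

theorem pt_congr_on_Ioo {T x t : ℝ} {w z : ℝ → ℝ → ℝ} (h : ∀ s ∈ Ioo 0 T, w s x = z s x)
    (ht : t ∈ Ioo 0 T) : pt w t x = pt z t x :=
  Filter.EventuallyEq.deriv_eq (Filter.eventually_of_mem (Ioo_mem_nhds ht.1 ht.2) h)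

/-- Nonnegative solutions whose initial data are bounded by `R`. -/
structure AdmissibleSolution (a b μ ν T R : ℝ) (u θ : ℝ → ℝ → ℝ) : Prop where
  sol : IsRegSolution a b μ T ν u θ
  nonneg : ∀ t ∈ Icc (0:ℝ) T, ∀ x ∈ Icc a b, 0 ≤ θ t x
  init_u : (∫ x in a..b, ((u 0 x) ^ 2 + (px u 0 x) ^ 2 + (px (px u) 0 x) ^ 2)) ≤ R
  init_pt_u :
    (∫ x in a..b, ((pt u 0 x) ^ 2 + (px (pt u) 0 x) ^ 2 + (px (px (pt u)) 0 x) ^ 2)) ≤ R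
  init_θ : (∫ x in a..b, ((θ 0 x) ^ 2 + (px θ 0 x) ^ 2 + (px (px θ) 0 x) ^ 2
        + (px (px (px θ)) 0 x) ^ 2)) ≤ R

namespace AdmissibleSolution

variable {a b μ ν T R : ℝ} {u θ : ℝ → ℝ → ℝ}

theorem smooth_u (h : AdmissibleSolution a b μ ν T R u θ) : SmoothPlane u := h.sol.1

theorem smooth_θ (h : AdmissibleSolution a b μ ν T R u θ) : SmoothPlane θ := h.sol.2.1

theorem pt_pt_u_eq (h : AdmissibleSolution a b μ ν T R u θ) {t x : ℝ} (ht : t ∈ Icc 0 T)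
    (hx : x ∈ Icc a b) :
    pt (pt u) t x = px (px u) t x + ν * px (px (pt u)) t x - μ * px θ t x := by
  linarith [h.sol.2.2.1 t ht x hx]

theorem pt_θ_eq (h : AdmissibleSolution a b μ ν T R u θ) {t x : ℝ} (ht : t ∈ Icc 0 T)
    (hx : x ∈ Icc a b) :
    pt θ t x = px (px θ) t x - μ * θ t x * px (pt u) t x := by
  linarith [h.sol.2.2.2.1 t ht x hx]

theorem pt_u_boundary (h : AdmissibleSolution a b μ ν T R u θ) {t : ℝ} (ht : t ∈ Ioo 0 T) :
    pt u t a = 0 ∧ pt u t b = 0 := by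
  have hu := h.sol.2.2.2.2.1
  constructor
  · refine (pt_congr_on_Ioo (z := fun _ _ => 0)
      (fun s hs => (hu s (Ioo_subset_Icc_self hs)).1) ht).trans ?_
    simp [pt]
  · refine (pt_congr_on_Ioo (z := fun _ _ => 0)
      (fun s hs => (hu s (Ioo_subset_Icc_self hs)).2) ht).trans ?_
    simp [pt]

theorem pt_pt_u_boundary (h : AdmissibleSolution a b μ ν T R u θ) {t : ℝ} (ht : t ∈ Ioo 0 T) :
    pt (pt u) t a = 0 ∧ pt (pt u) t b = 0 := by
  constructor
  · refine (pt_congr_on_Ioo (z := fun _ _ => 0) (fun s hs => (h.pt_u_boundary hs).1) ht).trans ?_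
    simp [pt]
  · refine (pt_congr_on_Ioo (z := fun _ _ => 0) (fun s hs => (h.pt_u_boundary hs).2) ht).trans ?_
    simp [pt]

theorem px_θ_boundary (h : AdmissibleSolution a b μ ν T R u θ) {t : ℝ} (ht : t ∈ Icc 0 T) :
    px θ t a = 0 ∧ px θ t b = 0 :=
  h.sol.2.2.2.2.2 t ht

theorem px_pt_θ_boundary (h : AdmissibleSolution a b μ ν T R u θ) {t : ℝ} (ht : t ∈ Ioo 0 T) :
    px (pt θ) t a = 0 ∧ px (pt θ) t b = 0 := by
  rw [← h.smooth_θ.pt_px]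
  constructor
  · refine (pt_congr_on_Ioo (z := fun _ _ => 0)
      (fun s hs => (h.px_θ_boundary (Ioo_subset_Icc_self hs)).1) ht).trans ?_
    simp [pt]
  · refine (pt_congr_on_Ioo (z := fun _ _ => 0)
      (fun s hs => (h.px_θ_boundary (Ioo_subset_Icc_self hs)).2) ht).trans ?_
    simp [pt]

theorem pt_pt_pt_u_eq (h : AdmissibleSolution a b μ ν T R u θ) {t x : ℝ} (ht : t ∈ Ioo 0 T)
    (hx : x ∈ Icc a b) :
    pt (pt (pt u)) t x =
      px (px (pt u)) t x + ν * px (px (pt (pt u))) t x - μ * px (pt θ) t x := by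
  have su := h.smooth_u
  have sθ := h.smooth_θ
  rw [pt_congr_on_Ioo
    (z := fun s x => px (px u) s x + ν * px (px (pt u)) s x - μ * px θ s x)
    (fun s hs => h.pt_pt_u_eq (Ioo_subset_Icc_self hs) hx) ht]
  have h₁ := su.px.px.hasDerivAt_pt t x
  have h₂ := su.pt.px.px.hasDerivAt_pt t x
  have h₃ := sθ.px.hasDerivAt_pt t x
  rw [su.px.pt_px, su.pt_px] at h₁
  rw [su.pt.px.pt_px, su.pt.pt_px] at h₂
  rw [sθ.pt_px] at h₃
  exact ((h₁.add (h₂.const_mul ν)).sub (h₃.const_mul μ)).deriv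

theorem pt_pt_θ_eq (h : AdmissibleSolution a b μ ν T R u θ) {t x : ℝ} (ht : t ∈ Ioo 0 T)
    (hx : x ∈ Icc a b) :
    pt (pt θ) t x = px (px (pt θ)) t x
      - μ * (pt θ t x * px (pt u) t x + θ t x * px (pt (pt u)) t x) := by
  have su := h.smooth_u
  have sθ := h.smooth_θ
  rw [pt_congr_on_Ioo (z := fun s x => px (px θ) s x - μ * θ s x * px (pt u) s x)
    (fun s hs => h.pt_θ_eq (Ioo_subset_Icc_self hs) hx) ht]
  have h₁ := sθ.px.px.hasDerivAt_pt t x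
  have h₂ := su.pt.px.hasDerivAt_pt t x
  have h₃ := sθ.hasDerivAt_pt t x
  rw [sθ.px.pt_px, sθ.pt_px] at h₁
  rw [su.pt.pt_px] at h₂
  refine (h₁.sub ((h₃.const_mul μ).mul h₂)).deriv.trans ?_
  ring

theorem px_pt_θ_initial (h : AdmissibleSolution a b μ ν T R u θ) (hab : a < b) (hT : 0 < T)
    {x : ℝ} (hx : x ∈ Icc a b) :
    px (pt θ) 0 x = px (px (px θ)) 0 x
      - μ * (px θ 0 x * px (pt u) 0 x + θ 0 x * px (px (pt u)) 0 x) := by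
  have su := h.smooth_u
  have sθ := h.smooth_θ
  have hEq : EqOn (px (pt θ) 0) (fun x => px (px (px θ)) 0 x
      - μ * (px θ 0 x * px (pt u) 0 x + θ 0 x * px (px (pt u)) 0 x)) (Ioo a b) := by
    intro y hy
    have hev : pt θ 0 =ᶠ[nhds y] fun z => px (px θ) 0 z - μ * θ 0 z * px (pt u) 0 z :=
      Filter.eventually_of_mem (Ioo_mem_nhds hy.1 hy.2) fun z hz =>
        h.pt_θ_eq ⟨le_rfl, hT.le⟩ (Ioo_subset_Icc_self hz)
    refine hev.deriv_eq.trans ?_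
    refine ((sθ.px.px.hasDerivAt_px 0 y).sub
      (((sθ.hasDerivAt_px 0 y).const_mul μ).mul (su.pt.px.hasDerivAt_px 0 y))).deriv.trans ?_
    ring
  have c₀ := sθ.continuous_slice 0
  have c₁ := sθ.px.continuous_slice 0
  have c₃ := sθ.px.px.px.continuous_slice 0
  have d₁ := su.pt.px.continuous_slice 0
  have d₂ := su.pt.px.px.continuous_slice 0
  refine (hEq.closure (sθ.pt.px.continuous_slice 0)
    (c₃.sub (continuous_const.mul ((c₁.mul d₁).add (c₀.mul d₂))))) ?_
  rwa [closure_Ioo hab.ne]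

theorem sqInt_initial_u (h : AdmissibleSolution a b μ ν T R u θ) (hab : a < b) :
    sqInt a b (px u 0) ≤ R ∧ sqInt a b (px (px u) 0) ≤ R := by
  have su := h.smooth_u
  have c₀ := su.continuous_slice 0
  have c₁ := su.px.continuous_slice 0
  have c₂ := su.px.px.continuous_slice 0
  have hc := (((c₀.pow 2).add (c₁.pow 2)).add (c₂.pow 2)).intervalIntegrable (μ := volume) a b
  have hi := h.init_u
  refine ⟨le_trans (intervalIntegral.integral_mono_on hab.le
    ((c₁.pow 2).intervalIntegrable _ _) hc fun x _ => ?_) hi,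
    le_trans (intervalIntegral.integral_mono_on hab.le
    ((c₂.pow 2).intervalIntegrable _ _) hc fun x _ => ?_) hi⟩ <;>
  · simp only [Pi.add_apply, Pi.pow_apply]
    nlinarith [sq_nonneg (u 0 x), sq_nonneg (px u 0 x), sq_nonneg (px (px u) 0 x)]

theorem sqInt_initial_pt_u (h : AdmissibleSolution a b μ ν T R u θ) (hab : a < b) :
    sqInt a b (pt u 0) ≤ R ∧ sqInt a b (px (pt u) 0) ≤ R ∧
      sqInt a b (px (px (pt u)) 0) ≤ R := by
  have su := h.smooth_u
  have c₀ := su.pt.continuous_slice 0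
  have c₁ := su.pt.px.continuous_slice 0
  have c₂ := su.pt.px.px.continuous_slice 0
  have hc := (((c₀.pow 2).add (c₁.pow 2)).add (c₂.pow 2)).intervalIntegrable (μ := volume) a b
  have hi := h.init_pt_u
  refine ⟨le_trans (intervalIntegral.integral_mono_on hab.le
    ((c₀.pow 2).intervalIntegrable _ _) hc fun x _ => ?_) hi,
    le_trans (intervalIntegral.integral_mono_on hab.le
    ((c₁.pow 2).intervalIntegrable _ _) hc fun x _ => ?_) hi,
    le_trans (intervalIntegral.integral_mono_on hab.le
    ((c₂.pow 2).intervalIntegrable _ _) hc fun x _ => ?_) hi⟩ <;>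
  · simp only [Pi.add_apply, Pi.pow_apply]
    nlinarith [sq_nonneg (pt u 0 x), sq_nonneg (px (pt u) 0 x), sq_nonneg (px (px (pt u)) 0 x)]

theorem sqInt_initial_θ (h : AdmissibleSolution a b μ ν T R u θ) (hab : a < b) :
    sqInt a b (θ 0) ≤ R ∧ sqInt a b (px θ 0) ≤ R ∧ sqInt a b (px (px θ) 0) ≤ R ∧
      sqInt a b (px (px (px θ)) 0) ≤ R := by
  have sθ := h.smooth_θ
  have c₀ := sθ.continuous_slice 0
  have c₁ := sθ.px.continuous_slice 0
  have c₂ := sθ.px.px.continuous_slice 0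
  have c₃ := sθ.px.px.px.continuous_slice 0
  have hc := ((((c₀.pow 2).add (c₁.pow 2)).add (c₂.pow 2)).add (c₃.pow 2)).intervalIntegrable
    (μ := volume) a b
  have hi := h.init_θ
  refine ⟨le_trans (intervalIntegral.integral_mono_on hab.le
    ((c₀.pow 2).intervalIntegrable _ _) hc fun x _ => ?_) hi,
    le_trans (intervalIntegral.integral_mono_on hab.le
    ((c₁.pow 2).intervalIntegrable _ _) hc fun x _ => ?_) hi,
    le_trans (intervalIntegral.integral_mono_on hab.le
    ((c₂.pow 2).intervalIntegrable _ _) hc fun x _ => ?_) hi,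
    le_trans (intervalIntegral.integral_mono_on hab.le
    ((c₃.pow 2).intervalIntegrable _ _) hc fun x _ => ?_) hi⟩ <;>
  · simp only [Pi.add_apply, Pi.pow_apply]
    nlinarith [sq_nonneg (θ 0 x), sq_nonneg (px θ 0 x), sq_nonneg (px (px θ) 0 x),
      sq_nonneg (px (px (px θ)) 0 x)]

end AdmissibleSolution

/-- Energy estimate: the kinetic energy and the total viscous dissipation are bounded. -/
theorem exists_kinetic_energy_bound (a b μ ν T R : ℝ) (hab : a < b) (hν : 0 < ν)
    (hT : 0 < T) (hR : 0 < R) :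
    ∃ B > (0 : ℝ), ∀ u θ : ℝ → ℝ → ℝ, AdmissibleSolution a b μ ν T R u θ →
      (∀ t ∈ Icc 0 T, sqInt a b (pt u t) ≤ B) ∧
        ∫ t in (0 : ℝ)..T, sqInt a b (px (pt u) t) ≤ B := by
  have hba : 0 < b - a := sub_pos.2 hab
  obtain ⟨B, hB, hbound⟩ := exists_energy_bound T 0 0 (R + R + 2 * (b - a + R)) hT le_rfl le_rfl
    (by positivity)
  refine ⟨B + B / (2 * ν), by positivity, fun u θ h => ?_⟩
  have su := h.smooth_u
  have sθ := h.smooth_θ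
  have hθ0 : ∀ t ∈ Icc 0 T, 0 ≤ ∫ x in a..b, θ t x := fun t ht =>
    intervalIntegral.integral_nonneg hab.le (h.nonneg t ht)
  have hθinit : ∫ x in a..b, θ 0 x ≤ b - a + R := by
    have h₁ := integral_le_linear_combination hab.le (sθ.continuous_slice 0)
      (continuous_const (y := (1 : ℝ))) ((sθ.continuous_slice 0).fun_pow 2)
      (continuous_const (y := (0 : ℝ))) 1 1 0 (fun x _ => by
        nlinarith [sq_nonneg (θ 0 x - 1), sq_nonneg (θ 0 x)])
    have h₂ := (h.sqInt_initial_θ hab).1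
    simp only [sqInt] at h₂
    simp at h₁
    linarith
  obtain ⟨h₁, h₂⟩ := hbound
    (fun t => sqInt a b (pt u t) + sqInt a b (px u t) + 2 * ∫ x in a..b, θ t x)
    (fun t => 2 * (∫ x in a..b, pt u t x * pt (pt u) t x)
      + 2 * (∫ x in a..b, px u t x * pt (px u) t x) + 2 * ∫ x in a..b, pt θ t x)
    (fun t => 2 * ν * sqInt a b (px (pt u) t)) (fun _ => 0)
    (fun t => ((su.pt.hasDerivAt_sqInt a b t).add (su.px.hasDerivAt_sqInt a b t)).add
      ((sθ.hasDerivAt_integral a b t).const_mul 2))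
    (continuous_const.fun_mul (su.pt.px.continuous_sqInt a b)) continuous_const
    (fun t ht => add_nonneg (add_nonneg (sqInt_nonneg hab.le _) (sqInt_nonneg hab.le _))
      (mul_nonneg zero_le_two (hθ0 t ht)))
    (fun t _ => mul_nonneg (by positivity) (sqInt_nonneg hab.le _))
    (fun _ _ => le_rfl)
    (by linarith [(h.sqInt_initial_u hab).1, (h.sqInt_initial_pt_u hab).1])
    (by simp)
    (fun t ht => by
      have ht' := Ioo_subset_Icc_self ht
      obtain ⟨hva, hvb⟩ := h.pt_u_boundary ht
      obtain ⟨hθa, hθb⟩ := h.px_θ_boundary ht'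
      have c := su.pt.continuous_slice t
      have c' := su.pt.px.continuous_slice t
      have cθ := sθ.continuous_slice t
      have e₁ := integral_le_linear_combination hab.le (c.fun_mul (su.pt.pt.continuous_slice t))
        (c.fun_mul (su.px.px.continuous_slice t)) (c.fun_mul (su.pt.px.px.continuous_slice t))
        (c.fun_mul (sθ.px.continuous_slice t)) 1 ν (-μ) (fun x hx => by
          rw [h.pt_pt_u_eq ht' hx]
          apply le_of_eq
          ring)
      have e₂ := integral_le_linear_combination hab.le (sθ.pt.continuous_slice t)
        (sθ.px.px.continuous_slice t) (c'.fun_mul cθ)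
        (continuous_const (y := (0 : ℝ))) 1 (-μ) 0 (fun x hx => by
          rw [h.pt_θ_eq ht' hx]
          apply le_of_eq
          ring)
      have i₁ := su.pt.integral_mul_px su.px (a := a) (b := b) (t := t)
        (by rw [hva, zero_mul]) (by rw [hvb, zero_mul])
      have i₂ := su.pt.integral_mul_px su.pt.px (a := a) (b := b) (t := t)
        (by rw [hva, zero_mul]) (by rw [hvb, zero_mul])
      have i₃ := su.pt.integral_mul_px sθ (a := a) (b := b) (t := t)
        (by rw [hva, zero_mul]) (by rw [hvb, zero_mul])
      have i₄ : ∫ x in a..b, px (px θ) t x = 0 := by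
        rw [intervalIntegral.integral_eq_sub_of_hasDerivAt
          (fun x _ => sθ.px.hasDerivAt_px t x)
          ((sθ.px.px.continuous_slice t).intervalIntegrable _ _), hθa, hθb, sub_zero]
      have i₅ : ∫ x in a..b, px u t x * pt (px u) t x = ∫ x in a..b, px (pt u) t x * px u t x := by
        rw [su.pt_px]
        simp only [mul_comm]
      have i₆ : ∫ x in a..b, px (pt u) t x * px (pt u) t x = sqInt a b (px (pt u) t) := by
        simp only [sqInt, pow_two]
      rw [i₁, i₂, i₃, i₆] at e₁
      rw [i₄] at e₂
      rw [i₅]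
      linarith)
  have hB' : 0 ≤ B / (2 * ν) := by positivity
  refine ⟨fun t ht => ?_, ?_⟩
  · have := h₁ t ht
    linarith [hθ0 t ht, sqInt_nonneg hab.le (px u t)]
  · rw [intervalIntegral.integral_const_mul] at h₂
    have : ∫ t in (0 : ℝ)..T, sqInt a b (px (pt u) t) ≤ B / (2 * ν) := by
      rw [le_div_iff₀ (by positivity)]
      linarith
    linarith

/-- The temperature is bounded in `L^∞(L²) ∩ L²(H¹)`. -/
theorem exists_temperature_bound (a b μ ν T R : ℝ) (hab : a < b) (hν : 0 < ν)
    (hT : 0 < T) (hR : 0 < R) :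
    ∃ B > (0 : ℝ), ∀ u θ : ℝ → ℝ → ℝ, AdmissibleSolution a b μ ν T R u θ →
      (∀ t ∈ Icc 0 T, sqInt a b (θ t) ≤ B) ∧
        ∫ t in (0 : ℝ)..T, sqInt a b (px θ t) ≤ B := by
  have hba : 0 < b - a := sub_pos.2 hab
  obtain ⟨B₁, hB₁, hkin⟩ := exists_kinetic_energy_bound a b μ ν T R hab hν hT hR
  set K := 1 / (b - a) + 1 with hK
  have hK0 : 0 < K := by positivity
  obtain ⟨B, hB, hbound⟩ := exists_energy_bound T (4 * μ ^ 2 * K * (B₁ + 1)) B₁ R hT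
    (by positivity) hB₁.le hR.le
  refine ⟨B, hB, fun u θ h => ?_⟩
  obtain ⟨hv, hvx⟩ := hkin u θ h
  have su := h.smooth_u
  have sθ := h.smooth_θ
  refine hbound (fun t => sqInt a b (θ t)) (fun t => 2 * ∫ x in a..b, θ t x * pt θ t x)
    (fun t => sqInt a b (px θ t)) (fun t => sqInt a b (px (pt u) t))
    (sθ.hasDerivAt_sqInt a b) (sθ.px.continuous_sqInt a b) (su.pt.px.continuous_sqInt a b)
    (fun t _ => sqInt_nonneg hab.le _) (fun t _ => sqInt_nonneg hab.le _)
    (fun t _ => sqInt_nonneg hab.le _) (h.sqInt_initial_θ hab).1 hvx (fun t ht => ?_)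
  have ht' := Ioo_subset_Icc_self ht
  obtain ⟨hva, hvb⟩ := h.pt_u_boundary ht
  obtain ⟨hθa, hθb⟩ := h.px_θ_boundary ht'
  have c := su.pt.continuous_slice t
  have c' := su.pt.px.continuous_slice t
  have cθ := sθ.continuous_slice t
  have cθ' := sθ.px.continuous_slice t
  set S := K * (sqInt a b (pt u t) + sqInt a b (px (pt u) t)) with hS
  have hvS : ∀ x ∈ Icc a b, pt u t x ^ 2 ≤ S := fun x hx =>
    su.pt.sq_le_sqInt_add_sqInt hab t hx
  have e₁ := integral_le_linear_combination hab.le (cθ.fun_mul (sθ.pt.continuous_slice t))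
    (cθ.fun_mul (sθ.px.px.continuous_slice t)) ((cθ.fun_mul cθ).fun_mul c')
    (continuous_const (y := (0 : ℝ))) 1 (-μ) 0 (fun x hx => by
      rw [h.pt_θ_eq ht' hx]
      apply le_of_eq
      ring)
  have i₁ := sθ.integral_mul_px sθ.px (a := a) (b := b) (t := t)
    (by rw [hθa, mul_zero]) (by rw [hθb, mul_zero])
  have i₂ := (sθ.mul sθ).integral_mul_px su.pt (a := a) (b := b) (t := t)
    (by rw [hva, mul_zero]) (by rw [hvb, mul_zero])
  have hpx : ∀ x, px (fun t x => θ t x * θ t x) t x = 2 * (θ t x * px θ t x) := fun x =>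
    ((sθ.hasDerivAt_px t x).mul (sθ.hasDerivAt_px t x)).deriv.trans (by ring)
  simp only [hpx, mul_assoc, intervalIntegral.integral_const_mul] at i₂
  have e₂ := integral_le_linear_combination hab.le
    (continuous_const.fun_mul (cθ.fun_mul (cθ'.fun_mul c)))
    (cθ'.fun_pow 2) (cθ.fun_pow 2) (continuous_const (y := (0 : ℝ))) 1 (4 * μ ^ 2 * S) 0
    (f := fun x => 4 * μ * (θ t x * (px θ t x * pt u t x))) (fun x hx => by
      have h₁ := mul_le_mul_of_nonneg_left (hvS x hx) (mul_nonneg (sq_nonneg (2 * μ))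
        (sq_nonneg (θ t x)))
      nlinarith [sq_nonneg (px θ t x - 2 * μ * (θ t x * pt u t x))])
  rw [intervalIntegral.integral_const_mul] at e₂
  have i₃ : ∫ x in a..b, px θ t x * px θ t x = sqInt a b (px θ t) := by
    simp only [sqInt, pow_two]
  change _ ≤ 1 * sqInt a b (px θ t) + (4 * μ ^ 2 * S) * sqInt a b (θ t) + _ at e₂
  rw [i₁, i₃] at e₁
  simp only [mul_assoc] at e₁
  rw [i₂] at e₁
  have hθ0 := sqInt_nonneg hab.le (θ t)
  have hq0 := sqInt_nonneg hab.le (px (pt u) t)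
  have hSle : S ≤ K * ((B₁ + 1) * (1 + sqInt a b (px (pt u) t))) := by
    have := hv t ht'
    rw [hS]
    gcongr
    nlinarith
  have hSle' : 4 * μ ^ 2 * S * sqInt a b (θ t)
      ≤ 4 * μ ^ 2 * (K * ((B₁ + 1) * (1 + sqInt a b (px (pt u) t)))) * (1 + sqInt a b (θ t)) := by
    gcongr
    linarith
  linarith

/-- The velocity is bounded in `L^∞(H¹)`. -/
theorem exists_velocity_gradient_bound (a b μ ν T R : ℝ) (hab : a < b) (hν : 0 < ν)
    (hT : 0 < T) (hR : 0 < R) :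
    ∃ B > (0 : ℝ), ∀ u θ : ℝ → ℝ → ℝ, AdmissibleSolution a b μ ν T R u θ →
      ∀ t ∈ Icc 0 T, sqInt a b (px (pt u) t) ≤ B := by
  obtain ⟨B₁, hB₁, htemp⟩ := exists_temperature_bound a b μ ν T R hab hν hT hR
  obtain ⟨B, hB, hbound⟩ := exists_energy_bound T (μ ^ 2 / (2 * ν)) B₁ (R + R) hT
    (by positivity) hB₁.le (by positivity)
  refine ⟨B, hB, fun u θ h => ?_⟩
  have su := h.smooth_u
  have sθ := h.smooth_θ
  obtain ⟨h₁, -⟩ := hbound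
    (fun t => sqInt a b (px (pt u) t) + sqInt a b (px (px u) t))
    (fun t => 2 * (∫ x in a..b, px (pt u) t x * pt (px (pt u)) t x)
      + 2 * (∫ x in a..b, px (px u) t x * pt (px (px u)) t x))
    (fun _ => 0) (fun t => sqInt a b (px θ t))
    (fun t => (su.pt.px.hasDerivAt_sqInt a b t).add (su.px.px.hasDerivAt_sqInt a b t))
    continuous_const (sθ.px.continuous_sqInt a b)
    (fun t _ => add_nonneg (sqInt_nonneg hab.le _) (sqInt_nonneg hab.le _))
    (fun _ _ => le_rfl) (fun t _ => sqInt_nonneg hab.le _)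
    (add_le_add (h.sqInt_initial_pt_u hab).2.1 (h.sqInt_initial_u hab).2) (htemp u θ h).2
    (fun t ht => by
      have ht' := Ioo_subset_Icc_self ht
      obtain ⟨hwa, hwb⟩ := h.pt_pt_u_boundary ht
      have c := su.pt.px.px.continuous_slice t
      rw [su.pt.pt_px, su.px.pt_px, su.pt_px]
      have i₁ := su.pt.px.integral_mul_px su.pt.pt (a := a) (b := b) (t := t)
        (by rw [hwa, mul_zero]) (by rw [hwb, mul_zero])
      have e₁ := integral_le_linear_combination hab.le
        ((su.px.px.continuous_slice t).fun_mul c) (c.fun_mul (su.pt.pt.continuous_slice t))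
        ((sθ.px.continuous_slice t).fun_pow 2) (continuous_const (y := (0 : ℝ)))
        1 (μ ^ 2 / (4 * ν)) 0 (fun x hx => by
          rw [h.pt_pt_u_eq ht' hx]
          have key : ν * px (px (pt u)) t x ^ 2 - μ * px θ t x * px (px (pt u)) t x
              + μ ^ 2 / (4 * ν) * px θ t x ^ 2
              = ν * (px (px (pt u)) t x - μ / (2 * ν) * px θ t x) ^ 2 := by
            field_simp
            ring
          have : 0 ≤ ν * (px (px (pt u)) t x - μ / (2 * ν) * px θ t x) ^ 2 := by positivity
          nlinarith)
      change _ ≤ _ + (μ ^ 2 / (4 * ν)) * sqInt a b (px θ t) + _ at e₁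
      rw [i₁]
      have hμν : μ ^ 2 / (2 * ν) = 2 * (μ ^ 2 / (4 * ν)) := by
        field_simp
        ring
      have hA : 0 ≤ μ ^ 2 / (4 * ν) := by positivity
      have hq := sqInt_nonneg hab.le (px θ t)
      have hE := add_nonneg (sqInt_nonneg hab.le (px (pt u) t)) (sqInt_nonneg hab.le (px (px u) t))
      rw [hμν]
      have : 2 * (μ ^ 2 / (4 * ν)) * sqInt a b (px θ t) ≤
          2 * (μ ^ 2 / (4 * ν)) * ((1 + sqInt a b (px θ t))
            * (1 + (sqInt a b (px (pt u) t) + sqInt a b (px (px u) t)))) := by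
        gcongr
        nlinarith [mul_nonneg hq hE]
      linarith)
  intro t ht
  linarith [h₁ t ht, sqInt_nonneg hab.le (px (px u) t)]

/-- The temperature is bounded in `L^∞(H¹) ∩ L²(H²)`. -/
theorem exists_temperature_gradient_bound (a b μ ν T R : ℝ) (hab : a < b)
    (hν : 0 < ν) (hT : 0 < T) (hR : 0 < R) :
    ∃ B > (0 : ℝ), ∀ u θ : ℝ → ℝ → ℝ, AdmissibleSolution a b μ ν T R u θ →
      (∀ t ∈ Icc 0 T, sqInt a b (px θ t) ≤ B) ∧
        ∫ t in (0 : ℝ)..T, sqInt a b (px (px θ) t) ≤ B := by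
  have hba : 0 < b - a := sub_pos.2 hab
  obtain ⟨B₁, hB₁, htemp⟩ := exists_temperature_bound a b μ ν T R hab hν hT hR
  obtain ⟨B₂, hB₂, hvel⟩ := exists_velocity_gradient_bound a b μ ν T R hab hν hT hR
  set K := 1 / (b - a) + 1 with hK
  have hK0 : 0 < K := by positivity
  obtain ⟨B, hB, hbound⟩ := exists_energy_bound T (μ ^ 2 * K * (B₁ + 1) * B₂) B₁ R hT
    (by positivity) hB₁.le hR.le
  refine ⟨B, hB, fun u θ h => ?_⟩
  obtain ⟨hθ, hθx⟩ := htemp u θ h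
  have su := h.smooth_u
  have sθ := h.smooth_θ
  refine hbound (fun t => sqInt a b (px θ t)) (fun t => 2 * ∫ x in a..b, px θ t x * pt (px θ) t x)
    (fun t => sqInt a b (px (px θ) t)) (fun t => sqInt a b (px θ t))
    (sθ.px.hasDerivAt_sqInt a b) (sθ.px.px.continuous_sqInt a b) (sθ.px.continuous_sqInt a b)
    (fun t _ => sqInt_nonneg hab.le _) (fun t _ => sqInt_nonneg hab.le _)
    (fun t _ => sqInt_nonneg hab.le _) (h.sqInt_initial_θ hab).2.1 hθx (fun t ht => ?_)
  have ht' := Ioo_subset_Icc_self ht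
  obtain ⟨hθa, hθb⟩ := h.px_θ_boundary ht'
  set S := K * (sqInt a b (θ t) + sqInt a b (px θ t)) with hS
  have hθS : ∀ x ∈ Icc a b, θ t x ^ 2 ≤ S := fun x hx =>
    sθ.sq_le_sqInt_add_sqInt hab t hx
  have c := sθ.px.px.continuous_slice t
  rw [sθ.pt_px]
  have i₁ := sθ.px.integral_mul_px sθ.pt (a := a) (b := b) (t := t)
    (by rw [hθa, zero_mul]) (by rw [hθb, zero_mul])
  have e₁ := integral_le_linear_combination hab.le (c.fun_pow 2)
    (c.fun_mul (sθ.pt.continuous_slice t)) ((su.pt.px.continuous_slice t).fun_pow 2)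
    (continuous_const (y := (0 : ℝ))) 2 (μ ^ 2 * S) 0 (fun x hx => by
      rw [h.pt_θ_eq ht' hx]
      have h₁ := mul_le_mul_of_nonneg_left (hθS x hx)
        (mul_nonneg (sq_nonneg μ) (sq_nonneg (px (pt u) t x)))
      nlinarith [sq_nonneg (px (px θ) t x - μ * θ t x * px (pt u) t x)])
  change sqInt a b (px (px θ) t) ≤ _ + (μ ^ 2 * S) * sqInt a b (px (pt u) t) + _ at e₁
  have hθ0 := sqInt_nonneg hab.le (θ t)
  have hq0 := sqInt_nonneg hab.le (px θ t)
  have hv0 := sqInt_nonneg hab.le (px (pt u) t)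
  have hSle : S ≤ K * ((B₁ + 1) * (1 + sqInt a b (px θ t))) := by
    have := hθ t ht'
    rw [hS]
    gcongr
    nlinarith
  have hle : μ ^ 2 * S * sqInt a b (px (pt u) t)
      ≤ μ ^ 2 * (K * ((B₁ + 1) * (1 + sqInt a b (px θ t)))) * B₂ := by
    gcongr
    exact hvel u θ h t ht'
  have hle' : μ ^ 2 * (K * ((B₁ + 1) * (1 + sqInt a b (px θ t)))) * B₂ * 1
      ≤ μ ^ 2 * (K * ((B₁ + 1) * (1 + sqInt a b (px θ t)))) * B₂ * (1 + sqInt a b (px θ t)) := by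
    gcongr
    linarith
  linarith

/-- Uniform bound on the temperature, and control of its time derivative by its second space
derivative. -/
theorem exists_temperature_sup_bound (a b μ ν T R : ℝ) (hab : a < b) (hν : 0 < ν)
    (hT : 0 < T) (hR : 0 < R) :
    ∃ B > (0 : ℝ), ∀ u θ : ℝ → ℝ → ℝ, AdmissibleSolution a b μ ν T R u θ →
      ∀ t ∈ Icc 0 T, (∀ x ∈ Icc a b, θ t x ^ 2 ≤ B) ∧
        sqInt a b (pt θ t) ≤ B * (1 + sqInt a b (px (px θ) t)) := by
  have hba : 0 < b - a := sub_pos.2 hab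
  obtain ⟨B₁, hB₁, htemp⟩ := exists_temperature_bound a b μ ν T R hab hν hT hR
  obtain ⟨B₂, hB₂, hvel⟩ := exists_velocity_gradient_bound a b μ ν T R hab hν hT hR
  obtain ⟨B₃, hB₃, hgrad⟩ := exists_temperature_gradient_bound a b μ ν T R hab hν hT hR
  set S := (1 / (b - a) + 1) * (B₁ + B₃) with hS
  have hS0 : 0 < S := by positivity
  have hC0 : 0 < 2 * μ ^ 2 * S * B₂ + 2 := by positivity
  refine ⟨S + (2 * μ ^ 2 * S * B₂ + 2), by positivity, fun u θ h t ht => ?_⟩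
  have su := h.smooth_u
  have sθ := h.smooth_θ
  have hθS : ∀ x ∈ Icc a b, θ t x ^ 2 ≤ S := fun x hx =>
    (sθ.sq_le_sqInt_add_sqInt hab t hx).trans (by
      rw [hS]
      gcongr
      · exact (htemp u θ h).1 t ht
      · exact (hgrad u θ h).1 t ht)
  refine ⟨fun x hx => by linarith [hθS x hx], ?_⟩
  have e₁ := integral_le_linear_combination hab.le ((sθ.pt.continuous_slice t).fun_pow 2)
    ((sθ.px.px.continuous_slice t).fun_pow 2) ((su.pt.px.continuous_slice t).fun_pow 2)
    (continuous_const (y := (0 : ℝ))) 2 (2 * μ ^ 2 * S) 0 (fun x hx => by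
      rw [h.pt_θ_eq ht hx]
      have h₁ := mul_le_mul_of_nonneg_left (hθS x hx)
        (mul_nonneg (sq_nonneg μ) (sq_nonneg (px (pt u) t x)))
      nlinarith [sq_nonneg (px (px θ) t x + μ * θ t x * px (pt u) t x)])
  change sqInt a b (pt θ t) ≤ 2 * sqInt a b (px (px θ) t)
    + (2 * μ ^ 2 * S) * sqInt a b (px (pt u) t) + _ at e₁
  have hle : 2 * μ ^ 2 * S * sqInt a b (px (pt u) t) ≤ 2 * μ ^ 2 * S * B₂ := by
    gcongr
    exact hvel u θ h t ht
  have hq0 := sqInt_nonneg hab.le (px (px θ) t)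
  have h₁ : 0 ≤ S * (1 + sqInt a b (px (px θ) t)) := by positivity
  have h₂ : 0 ≤ 2 * μ ^ 2 * S * B₂ * sqInt a b (px (px θ) t) := by positivity
  linarith

/-- The acceleration is bounded in `L²(H¹)`. -/
theorem exists_acceleration_bound (a b μ ν T R : ℝ) (hab : a < b) (hν : 0 < ν)
    (hT : 0 < T) (hR : 0 < R) :
    ∃ B > (0 : ℝ), ∀ u θ : ℝ → ℝ → ℝ, AdmissibleSolution a b μ ν T R u θ →
      ∫ t in (0 : ℝ)..T, sqInt a b (px (pt (pt u)) t) ≤ B := by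
  obtain ⟨B₁, hB₁, hgrad⟩ := exists_temperature_gradient_bound a b μ ν T R hab hν hT hR
  obtain ⟨B₂, hB₂, hsup⟩ := exists_temperature_sup_bound a b μ ν T R hab hν hT hR
  obtain ⟨B, hB, hbound⟩ := exists_energy_bound T (μ ^ 2 / ν * B₂) B₁
    (3 * R + 3 * ν ^ 2 * R + 3 * μ ^ 2 * R + R) hT (by positivity) hB₁.le (by positivity)
  refine ⟨B / ν, by positivity, fun u θ h => ?_⟩
  have su := h.smooth_u
  have sθ := h.smooth_θ
  have hinit : sqInt a b (pt (pt u) 0) ≤ 3 * R + 3 * ν ^ 2 * R + 3 * μ ^ 2 * R := by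
    have e₁ := integral_le_linear_combination hab.le ((su.pt.pt.continuous_slice 0).fun_pow 2)
      ((su.px.px.continuous_slice 0).fun_pow 2) ((su.pt.px.px.continuous_slice 0).fun_pow 2)
      ((sθ.px.continuous_slice 0).fun_pow 2) 3 (3 * ν ^ 2) (3 * μ ^ 2) (fun x hx => by
        rw [h.pt_pt_u_eq ⟨le_rfl, hT.le⟩ hx]
        nlinarith [sq_nonneg (px (px u) 0 x - ν * px (px (pt u)) 0 x),
          sq_nonneg (px (px u) 0 x + μ * px θ 0 x),
          sq_nonneg (ν * px (px (pt u)) 0 x + μ * px θ 0 x)])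
    refine le_trans e₁ ?_
    gcongr
    · exact (h.sqInt_initial_u hab).2
    · exact (h.sqInt_initial_pt_u hab).2.2
    · exact (h.sqInt_initial_θ hab).2.1
  obtain ⟨-, h₂⟩ := hbound
    (fun t => sqInt a b (pt (pt u) t) + sqInt a b (px (pt u) t))
    (fun t => 2 * (∫ x in a..b, pt (pt u) t x * pt (pt (pt u)) t x)
      + 2 * (∫ x in a..b, px (pt u) t x * pt (px (pt u)) t x))
    (fun t => ν * sqInt a b (px (pt (pt u)) t)) (fun t => sqInt a b (px (px θ) t))
    (fun t => (su.pt.pt.hasDerivAt_sqInt a b t).add (su.pt.px.hasDerivAt_sqInt a b t))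
    (continuous_const.mul (su.pt.pt.px.continuous_sqInt a b)) (sθ.px.px.continuous_sqInt a b)
    (fun t _ => add_nonneg (sqInt_nonneg hab.le _) (sqInt_nonneg hab.le _))
    (fun t _ => mul_nonneg hν.le (sqInt_nonneg hab.le _)) (fun t _ => sqInt_nonneg hab.le _)
    (add_le_add hinit (h.sqInt_initial_pt_u hab).2.1) (hgrad u θ h).2
    (fun t ht => by
      have ht' := Ioo_subset_Icc_self ht
      obtain ⟨hwa, hwb⟩ := h.pt_pt_u_boundary ht
      have c := su.pt.pt.continuous_slice t
      have c' := su.pt.pt.px.continuous_slice t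
      have cφ := sθ.pt.continuous_slice t
      have e₁ := integral_le_linear_combination hab.le (c.fun_mul (su.pt.pt.pt.continuous_slice t))
        (c.fun_mul (su.pt.px.px.continuous_slice t))
        (c.fun_mul (su.pt.pt.px.px.continuous_slice t))
        (c.fun_mul (sθ.pt.px.continuous_slice t)) 1 ν (-μ) (fun x hx => by
          rw [h.pt_pt_pt_u_eq ht hx]
          apply le_of_eq
          ring)
      have e₂ := integral_le_linear_combination hab.le
        (continuous_const.fun_mul (c'.fun_mul cφ)) (c'.fun_pow 2) (cφ.fun_pow 2)
        (continuous_const (y := (0 : ℝ))) ν (μ ^ 2 / ν) 0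
        (f := fun x => 2 * μ * (px (pt (pt u)) t x * pt θ t x)) (fun x _ => by
          have key : ν * px (pt (pt u)) t x ^ 2 - 2 * μ * (px (pt (pt u)) t x * pt θ t x)
              + μ ^ 2 / ν * pt θ t x ^ 2
              = ν * (px (pt (pt u)) t x - μ / ν * pt θ t x) ^ 2 := by
            field_simp
            ring
          have : 0 ≤ ν * (px (pt (pt u)) t x - μ / ν * pt θ t x) ^ 2 := by positivity
          linarith)
      rw [intervalIntegral.integral_const_mul] at e₂
      change _ ≤ ν * sqInt a b (px (pt (pt u)) t) + μ ^ 2 / ν * sqInt a b (pt θ t) + _ at e₂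
      have i₁ := su.pt.pt.integral_mul_px su.pt.px (a := a) (b := b) (t := t)
        (by rw [hwa, zero_mul]) (by rw [hwb, zero_mul])
      have i₂ := su.pt.pt.integral_mul_px su.pt.pt.px (a := a) (b := b) (t := t)
        (by rw [hwa, zero_mul]) (by rw [hwb, zero_mul])
      have i₃ := su.pt.pt.integral_mul_px sθ.pt (a := a) (b := b) (t := t)
        (by rw [hwa, zero_mul]) (by rw [hwb, zero_mul])
      have i₄ : ∫ x in a..b, px (pt u) t x * pt (px (pt u)) t x
          = ∫ x in a..b, px (pt (pt u)) t x * px (pt u) t x := by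
        rw [su.pt.pt_px]
        simp only [mul_comm]
      have i₅ : ∫ x in a..b, px (pt (pt u)) t x * px (pt (pt u)) t x
          = sqInt a b (px (pt (pt u)) t) := by
        simp only [sqInt, pow_two]
      rw [i₁, i₂, i₃, i₅] at e₁
      rw [i₄]
      have hq := sqInt_nonneg hab.le (px (px θ) t)
      have hE := add_nonneg (sqInt_nonneg hab.le (pt (pt u) t)) (sqInt_nonneg hab.le (px (pt u) t))
      have hle : μ ^ 2 / ν * sqInt a b (pt θ t)
          ≤ μ ^ 2 / ν * (B₂ * (1 + sqInt a b (px (px θ) t))) := by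
        gcongr
        exact (hsup u θ h t ht').2
      have hle' : μ ^ 2 / ν * (B₂ * (1 + sqInt a b (px (px θ) t))) * 1
          ≤ μ ^ 2 / ν * (B₂ * (1 + sqInt a b (px (px θ) t)))
            * (1 + (sqInt a b (pt (pt u) t) + sqInt a b (px (pt u) t))) := by
        gcongr
        linarith
      linarith)
  rw [intervalIntegral.integral_const_mul] at h₂
  rw [le_div_iff₀ hν]
  linarith

theorem exists_initial_bound (a b μ ν T R : ℝ) (hab : a < b) (hT : 0 < T) (hR : 0 < R) :
    ∃ B > (0 : ℝ), ∀ u θ : ℝ → ℝ → ℝ, AdmissibleSolution a b μ ν T R u θ →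
      sqInt a b (px (pt θ) 0) ≤ B := by
  have hba : 0 < b - a := sub_pos.2 hab
  set S := (1 / (b - a) + 1) * (R + R) with hS
  have hS0 : 0 < S := by positivity
  refine ⟨3 * R + 3 * μ ^ 2 * S * R + 3 * μ ^ 2 * S * R, by positivity, fun u θ h => ?_⟩
  have su := h.smooth_u
  have sθ := h.smooth_θ
  obtain ⟨hθ₀, hθ₁, hθ₂, hθ₃⟩ := h.sqInt_initial_θ hab
  have hθS : ∀ x ∈ Icc a b, θ 0 x ^ 2 ≤ S := fun x hx =>
    (sθ.sq_le_sqInt_add_sqInt hab 0 hx).trans (by rw [hS]; gcongr)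
  have hθxS : ∀ x ∈ Icc a b, px θ 0 x ^ 2 ≤ S := fun x hx =>
    (sθ.px.sq_le_sqInt_add_sqInt hab 0 hx).trans (by rw [hS]; gcongr)
  have e₁ := integral_le_linear_combination hab.le ((sθ.pt.px.continuous_slice 0).fun_pow 2)
    ((sθ.px.px.px.continuous_slice 0).fun_pow 2) ((su.pt.px.continuous_slice 0).fun_pow 2)
    ((su.pt.px.px.continuous_slice 0).fun_pow 2) 3 (3 * μ ^ 2 * S) (3 * μ ^ 2 * S)
    (fun x hx => by
      rw [h.px_pt_θ_initial hab hT hx]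
      have h₁ := mul_le_mul_of_nonneg_left (hθxS x hx)
        (mul_nonneg (sq_nonneg μ) (sq_nonneg (px (pt u) 0 x)))
      have h₂ := mul_le_mul_of_nonneg_left (hθS x hx)
        (mul_nonneg (sq_nonneg μ) (sq_nonneg (px (px (pt u)) 0 x)))
      nlinarith [sq_nonneg (px (px (px θ)) 0 x + μ * (px θ 0 x * px (pt u) 0 x)),
        sq_nonneg (px (px (px θ)) 0 x + μ * (θ 0 x * px (px (pt u)) 0 x)),
        sq_nonneg (μ * (px θ 0 x * px (pt u) 0 x) - μ * (θ 0 x * px (px (pt u)) 0 x))])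
  refine le_trans e₁ ?_
  gcongr
  · exact hθ₃
  · exact (h.sqInt_initial_pt_u hab).2.1
  · exact (h.sqInt_initial_pt_u hab).2.2

/-- The mixed derivative `θ_tx` is bounded in `L^∞(L²)`. -/
theorem exists_px_pt_temperature_bound (a b μ ν T R : ℝ) (hab : a < b)
    (hν : 0 < ν) (hT : 0 < T) (hR : 0 < R) :
    ∃ B > (0 : ℝ), ∀ u θ : ℝ → ℝ → ℝ, AdmissibleSolution a b μ ν T R u θ →
      ∀ t ∈ Icc 0 T, sqInt a b (px (pt θ) t) ≤ B := by
  have hba : 0 < b - a := sub_pos.2 hab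
  obtain ⟨B₁, hB₁, hgrad⟩ := exists_temperature_gradient_bound a b μ ν T R hab hν hT hR
  obtain ⟨B₂, hB₂, hsup⟩ := exists_temperature_sup_bound a b μ ν T R hab hν hT hR
  obtain ⟨B₃, hB₃, hvel⟩ := exists_velocity_gradient_bound a b μ ν T R hab hν hT hR
  obtain ⟨B₄, hB₄, hacc⟩ := exists_acceleration_bound a b μ ν T R hab hν hT hR
  obtain ⟨B₀, hB₀, hinit⟩ := exists_initial_bound a b μ ν T R hab hT hR
  set K := 1 / (b - a) + 1 with hK
  have hK0 : 0 < K := by positivity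
  obtain ⟨B, hB, hbound⟩ := exists_energy_bound T (μ ^ 2 * (K * (B₂ + 1) * B₃ + B₂)) (B₁ + B₄) B₀
    hT (by positivity) (by positivity) hB₀.le
  refine ⟨B, hB, fun u θ h => ?_⟩
  have su := h.smooth_u
  have sθ := h.smooth_θ
  refine (hbound (fun t => sqInt a b (px (pt θ) t))
    (fun t => 2 * ∫ x in a..b, px (pt θ) t x * pt (px (pt θ)) t x) (fun _ => 0)
    (fun t => sqInt a b (px (px θ) t) + sqInt a b (px (pt (pt u)) t))
    (sθ.pt.px.hasDerivAt_sqInt a b) continuous_const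
    ((sθ.px.px.continuous_sqInt a b).add (su.pt.pt.px.continuous_sqInt a b))
    (fun t _ => sqInt_nonneg hab.le _) (fun _ _ => le_rfl)
    (fun t _ => add_nonneg (sqInt_nonneg hab.le _) (sqInt_nonneg hab.le _)) (hinit u θ h) ?_
    (fun t ht => ?_)).1
  · rw [intervalIntegral.integral_add
      ((sθ.px.px.continuous_sqInt a b).intervalIntegrable _ _)
      ((su.pt.pt.px.continuous_sqInt a b).intervalIntegrable _ _)]
    exact add_le_add (hgrad u θ h).2 (hacc u θ h)
  have ht' := Ioo_subset_Icc_self ht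
  obtain ⟨hφa, hφb⟩ := h.px_pt_θ_boundary ht
  obtain ⟨hθS, hφ⟩ := hsup u θ h t ht'
  set S := K * (sqInt a b (pt θ t) + sqInt a b (px (pt θ) t)) with hS
  have hφS : ∀ x ∈ Icc a b, pt θ t x ^ 2 ≤ S := fun x hx =>
    sθ.pt.sq_le_sqInt_add_sqInt hab t hx
  have c := sθ.pt.px.px.continuous_slice t
  rw [sθ.pt.pt_px]
  have i₁ := sθ.pt.px.integral_mul_px sθ.pt.pt (a := a) (b := b) (t := t)
    (by rw [hφa, zero_mul]) (by rw [hφb, zero_mul])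
  have e₁ := integral_le_linear_combination hab.le (continuous_const (y := (0 : ℝ)))
    (c.fun_mul (sθ.pt.pt.continuous_slice t)) ((su.pt.px.continuous_slice t).fun_pow 2)
    ((su.pt.pt.px.continuous_slice t).fun_pow 2) 2 (μ ^ 2 * S) (μ ^ 2 * B₂) (fun x hx => by
      rw [h.pt_pt_θ_eq ht hx]
      have h₁ := mul_le_mul_of_nonneg_left (hφS x hx)
        (mul_nonneg (sq_nonneg μ) (sq_nonneg (px (pt u) t x)))
      have h₂ := mul_le_mul_of_nonneg_left (hθS x hx)
        (mul_nonneg (sq_nonneg μ) (sq_nonneg (px (pt (pt u)) t x)))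
      nlinarith [sq_nonneg (px (px (pt θ)) t x - μ * (pt θ t x * px (pt u) t x)),
        sq_nonneg (px (px (pt θ)) t x - μ * (θ t x * px (pt (pt u)) t x))])
  change _ ≤ _ + (μ ^ 2 * S) * sqInt a b (px (pt u) t)
    + (μ ^ 2 * B₂) * sqInt a b (px (pt (pt u)) t) at e₁
  rw [intervalIntegral.integral_zero] at e₁
  rw [i₁]
  have hE := sqInt_nonneg hab.le (px (pt θ) t)
  have hq₁ := sqInt_nonneg hab.le (px (px θ) t)
  have hq₂ := sqInt_nonneg hab.le (px (pt (pt u)) t)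
  have hv0 := sqInt_nonneg hab.le (px (pt u) t)
  have hφ0 := sqInt_nonneg hab.le (pt θ t)
  generalize sqInt a b (px (pt θ) t) = E at *
  generalize sqInt a b (px (px θ) t) = q₁ at *
  generalize sqInt a b (px (pt (pt u)) t) = q₂ at *
  have hSle : S ≤ K * ((B₂ + 1) * ((1 + (q₁ + q₂)) * (1 + E))) := by
    have hA : B₂ * (1 + q₁) + E ≤ (B₂ + 1) * ((1 + q₁) * (1 + E)) := by
      have : 0 ≤ B₂ * ((1 + q₁) * E) + (1 + q₁) + q₁ * E := by positivity
      linarith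
    rw [hS]
    gcongr
    calc sqInt a b (pt θ t) + E ≤ B₂ * (1 + q₁) + E := by gcongr
      _ ≤ (B₂ + 1) * ((1 + q₁) * (1 + E)) := hA
      _ ≤ _ := by
        gcongr
        linarith
  have hle : μ ^ 2 * S * sqInt a b (px (pt u) t)
      ≤ μ ^ 2 * (K * ((B₂ + 1) * ((1 + (q₁ + q₂)) * (1 + E)))) * B₃ := by
    gcongr
    exact hvel u θ h t ht'
  have hle' : μ ^ 2 * B₂ * q₂ ≤ μ ^ 2 * B₂ * ((1 + (q₁ + q₂)) * (1 + E)) := by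
    gcongr
    have : 0 ≤ (1 + (q₁ + q₂)) * E := by positivity
    linarith
  linarith

/-- **Higher-order regularity estimate for the artificial viscosity problem.**
For all `a < b`, `μ, ν, T, R > 0` there is `C > 0` depending only on `a, b, μ, ν, T, R`
such that any nonnegative smooth solution of the regularized system whose initial data satisfy
`‖u₀‖_{H²}² ≤ R`, `‖u₁‖_{H²}² ≤ R` and `‖θ₀‖_{H³}² ≤ R` satisfies
`sup_{t ∈ [0,T]} ‖θ_tx(t)‖_{L²} ≤ C`. -/
theorem higher_order_regularity (a b μ ν T R : ℝ) (hab : a < b) (hμ : 0 < μ) (hν : 0 < ν)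
    (hT : 0 < T) (hR : 0 < R) :
    ∃ C > (0:ℝ), ∀ u θ : ℝ → ℝ → ℝ,
      IsRegSolution a b μ T ν u θ →
      (∀ t ∈ Icc (0:ℝ) T, ∀ x ∈ Icc a b, 0 ≤ θ t x) →
      (∫ x in a..b, ((u 0 x) ^ 2 + (px u 0 x) ^ 2 + (px (px u) 0 x) ^ 2)) ≤ R →
      (∫ x in a..b, ((pt u 0 x) ^ 2 + (px (pt u) 0 x) ^ 2 + (px (px (pt u)) 0 x) ^ 2)) ≤ R →
      (∫ x in a..b, ((θ 0 x) ^ 2 + (px θ 0 x) ^ 2 + (px (px θ) 0 x) ^ 2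
        + (px (px (px θ)) 0 x) ^ 2)) ≤ R →
      ∀ t ∈ Icc (0:ℝ) T, L2norm a b (fun x => px (pt θ) t x) ≤ C := by
  obtain ⟨B, hB, hbound⟩ := exists_px_pt_temperature_bound a b μ ν T R hab hν hT hR
  refine ⟨Real.sqrt B, Real.sqrt_pos.2 hB, fun u θ hsol hθ h₀ h₁ h₂ t ht => ?_⟩
  exact Real.sqrt_le_sqrt (hbound u θ ⟨hsol, hθ, h₀, h₁, h₂⟩ t ht)
end

section
/- Let ν ≥ 0 and let (u, θ) be a smooth solution of the regularized thermoelasticity system on [0,T] with θ(0,x) ≥ 0 for all x ∈ [a,b]. Then θ(t,x) ≥ 0 for all (t,x) ∈ [0,T] × [a,b]. -/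
open Set MeasureTheory

open scoped ContDiff

/-- The time derivative of a smooth function of two variables is smooth. -/
lemma contDiff_uncurry_pt {w : ℝ → ℝ → ℝ} (hw : ContDiff ℝ ∞ (Function.uncurry w)) :
    ContDiff ℝ ∞ (Function.uncurry (pt w)) := by
  have hfd : ContDiff ℝ ∞ (fun p : ℝ × ℝ => fderiv ℝ (Function.uncurry w) p (1, 0)) :=
    (hw.fderiv_right (m := ∞) (by simp)).clm_apply contDiff_const
  convert hfd using 1
  ext ⟨t, x⟩
  have hcurve : HasDerivAt (fun s : ℝ => (s, x)) (1, 0) t :=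
    (hasDerivAt_id t).prodMk (hasDerivAt_const t x)
  exact ((hw.differentiable (by simp) (t, x)).hasFDerivAt.comp_hasDerivAt t hcurve).deriv

/-- The space derivative of a smooth function of two variables is smooth. -/
lemma contDiff_uncurry_px {w : ℝ → ℝ → ℝ} (hw : ContDiff ℝ ∞ (Function.uncurry w)) :
    ContDiff ℝ ∞ (Function.uncurry (px w)) := by
  have hfd : ContDiff ℝ ∞ (fun p : ℝ × ℝ => fderiv ℝ (Function.uncurry w) p (0, 1)) :=
    (hw.fderiv_right (m := ∞) (by simp)).clm_apply contDiff_const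
  convert hfd using 1
  ext ⟨t, x⟩
  have hcurve : HasDerivAt (fun y : ℝ => (t, y)) (0, 1) x :=
    (hasDerivAt_const x t).prodMk (hasDerivAt_id x)
  exact ((hw.differentiable (by simp) (t, x)).hasFDerivAt.comp_hasDerivAt x hcurve).deriv

/-- At a critical point that minimizes `f` over a nondegenerate interval, possibly at an endpoint,
the second derivative of `f` is nonnegative. -/
lemma deriv_deriv_nonneg_of_isMinOn_Icc {f : ℝ → ℝ} {a b x₀ : ℝ} (hab : a < b)
    (hf : Differentiable ℝ f) (hf' : Differentiable ℝ (deriv f)) (hx₀ : x₀ ∈ Icc a b)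
    (hmin : IsMinOn f (Icc a b) x₀) (hcrit : deriv f x₀ = 0) :
    0 ≤ deriv (deriv f) x₀ := by
  by_contra! hneg
  set d := deriv (deriv f) x₀ with hd
  -- Subtracting half of the quadratic Taylor term leaves a strict inequality to exploit.
  let g : ℝ → ℝ := fun x => -f x + d / 4 * (x - x₀) ^ 2
  have hg : ∀ x, HasDerivAt g (-deriv f x + d / 2 * (x - x₀)) x := fun x => by
    have hsq := (((hasDerivAt_id x).sub_const x₀).pow 2).const_mul (d / 4)
    refine ((hf x).hasDerivAt.neg.add hsq).congr_deriv ?_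
    simp
    ring
  have hg' : deriv g = fun x => -deriv f x + d / 2 * (x - x₀) := funext fun x => (hg x).deriv
  have hg'' : HasDerivAt (deriv g) (-d + d / 2) x₀ := by
    rw [hg']
    refine ((hf' x₀).hasDerivAt.neg.add
      (((hasDerivAt_id x₀).sub_const x₀).const_mul (d / 2))).congr_deriv ?_
    simp [hd]
  have hloc : IsLocalMin g x₀ := by
    refine isLocalMin_of_deriv_deriv_pos ?_ ?_ (hg x₀).continuousAt
    · rw [hg''.deriv]; linarith
    · rw [hg']; simp [hcrit]
  obtain ⟨ε, hε, hball⟩ := Metric.eventually_nhds_iff.1 hloc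
  obtain ⟨y, hy, hne, hdist⟩ : ∃ y ∈ Icc a b, y ≠ x₀ ∧ dist y x₀ < ε := by
    rcases hx₀.2.lt_or_eq with hlt | heq
    · have hpos : 0 < min (ε / 2) (b - x₀) := lt_min (by linarith) (by linarith)
      refine ⟨x₀ + min (ε / 2) (b - x₀), ⟨by linarith [hx₀.1], ?_⟩, by linarith, ?_⟩
      · linarith [min_le_right (ε / 2) (b - x₀)]
      · rw [Real.dist_eq, add_sub_cancel_left, abs_of_pos hpos]
        linarith [min_le_left (ε / 2) (b - x₀)]
    · have hpos : 0 < min (ε / 2) (b - a) := lt_min (by linarith) (by linarith)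
      refine ⟨x₀ - min (ε / 2) (b - a), ⟨?_, by linarith [hx₀.2]⟩, by linarith, ?_⟩
      · linarith [min_le_right (ε / 2) (b - a)]
      · rw [Real.dist_eq, sub_sub_cancel_left, abs_neg, abs_of_pos hpos]
        linarith [min_le_left (ε / 2) (b - a)]
  have hgy : -f x₀ ≤ -f y + d / 4 * (y - x₀) ^ 2 := by simpa [g] using hball hdist
  have hfy : f x₀ ≤ f y := hmin hy
  have hsq : 0 < (y - x₀) ^ 2 := by have := sub_ne_zero.2 hne; positivity
  nlinarith

/-- A differentiable function on the line attaining its minimum over `[s, t₀]` at the right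
endpoint has nonpositive derivative there. -/
lemma HasDerivAt.nonpos_of_isMinOn_Icc {f : ℝ → ℝ} {f' s t₀ : ℝ} (hs : s < t₀)
    (hf : HasDerivAt f f' t₀) (hmin : IsMinOn f (Icc s t₀) t₀) : f' ≤ 0 := by
  have hslope := hf.hasDerivWithinAt (s := Iio t₀)
  rw [hasDerivWithinAt_iff_tendsto_slope' (by simp)] at hslope
  refine le_of_tendsto hslope ?_
  filter_upwards [Ico_mem_nhdsLT hs] with y hy
  have hfy : f t₀ ≤ f y := hmin ⟨hy.1, hy.2.le⟩
  rw [slope_def_field]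
  exact div_nonpos_of_nonneg_of_nonpos (by linarith) (by linarith [hy.2])

/-- **Weak minimum principle** for the heat equation with a continuous zeroth-order coefficient
and homogeneous Neumann boundary conditions. -/
theorem nonneg_of_heat_neumann {a b T : ℝ} (hab : a < b) {θ c : ℝ → ℝ → ℝ}
    (hθ : ContDiff ℝ ∞ (Function.uncurry θ))
    (hc : ContinuousOn (Function.uncurry c) (Icc 0 T ×ˢ Icc a b))
    (heq : ∀ t ∈ Icc 0 T, ∀ x ∈ Icc a b, pt θ t x - px (px θ) t x + c t x * θ t x = 0)
    (hbdry : ∀ t ∈ Icc 0 T, px θ t a = 0 ∧ px θ t b = 0)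
    (hinit : ∀ x ∈ Icc a b, 0 ≤ θ 0 x) :
    ∀ t ∈ Icc 0 T, ∀ x ∈ Icc a b, 0 ≤ θ t x := by
  intro t₁ ht₁ x₁ hx₁
  by_contra! hneg
  have hK : IsCompact (Icc 0 T ×ˢ Icc a b) := isCompact_Icc.prod isCompact_Icc
  obtain ⟨m, hm⟩ := hK.bddBelow_image hc
  let l : ℝ := 1 - m
  have hl : ∀ t ∈ Icc 0 T, ∀ x ∈ Icc a b, 0 < l + c t x := fun t ht x hx => by
    have : m ≤ c t x := hm ⟨(t, x), ⟨ht, hx⟩, rfl⟩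
    linarith
  -- Minimize the exponentially damped function `exp (-l t) * θ`.
  let v : ℝ × ℝ → ℝ := fun p => Real.exp (-l * p.1) * Function.uncurry θ p
  have hv : Continuous v := by
    have := hθ.continuous
    fun_prop
  obtain ⟨⟨t₀, x₀⟩, ⟨ht₀, hx₀⟩, hmin⟩ :=
    hK.exists_isMinOn ⟨(t₁, x₁), ht₁, hx₁⟩ hv.continuousOn
  dsimp only at ht₀ hx₀
  have hv₀ : ∀ t ∈ Icc 0 T, ∀ x ∈ Icc a b,
      Real.exp (-l * t₀) * θ t₀ x₀ ≤ Real.exp (-l * t) * θ t x := fun t ht x hx =>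
    hmin (show (t, x) ∈ Icc 0 T ×ˢ Icc a b from ⟨ht, hx⟩)
  have hθ₀ : θ t₀ x₀ < 0 := by
    have h₁ := (hv₀ t₁ ht₁ x₁ hx₁).trans_lt (mul_neg_of_pos_of_neg (Real.exp_pos _) hneg)
    exact neg_of_mul_neg_right h₁ (Real.exp_pos _).le
  have ht₀pos : 0 < t₀ := by
    refine ht₀.1.lt_of_ne fun h => ?_
    subst h
    exact (hinit x₀ hx₀).not_gt hθ₀
  have hslice {w : ℝ → ℝ → ℝ} (hw : ContDiff ℝ ∞ (Function.uncurry w)) :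
      Differentiable ℝ (fun x => w t₀ x) :=
    (hw.differentiable (by simp)).comp (by fun_prop : Differentiable ℝ fun x : ℝ => (t₀, x))
  have hspace : IsMinOn (fun x => θ t₀ x) (Icc a b) x₀ := fun x hx =>
    le_of_mul_le_mul_left (hv₀ t₀ ht₀ x hx) (Real.exp_pos _)
  have hcrit : px θ t₀ x₀ = 0 := by
    rcases hx₀.1.eq_or_lt with h | hax
    · exact h ▸ (hbdry t₀ ht₀).1
    rcases hx₀.2.eq_or_lt with h | hxb
    · exact h ▸ (hbdry t₀ ht₀).2
    exact (hspace.isLocalMin (Icc_mem_nhds hax hxb)).deriv_eq_zero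
  have hxx : 0 ≤ px (px θ) t₀ x₀ :=
    deriv_deriv_nonneg_of_isMinOn_Icc hab (hslice hθ) (hslice (contDiff_uncurry_px hθ)) hx₀
      hspace hcrit
  have hθt : HasDerivAt (fun s => θ s x₀) (pt θ t₀ x₀) t₀ :=
    ((hθ.differentiable (by simp)).comp
      (by fun_prop : Differentiable ℝ fun s : ℝ => (s, x₀)) t₀).hasDerivAt
  have hexp : HasDerivAt (fun s => Real.exp (-l * s)) (Real.exp (-l * t₀) * -l) t₀ := by
    simpa using ((hasDerivAt_id t₀).const_mul (-l)).exp
  have ht : pt θ t₀ x₀ ≤ l * θ t₀ x₀ := by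
    have hnonpos := (hexp.mul hθt).nonpos_of_isMinOn_Icc ht₀pos
      (fun s hs => hv₀ s ⟨hs.1, hs.2.trans ht₀.2⟩ x₀ hx₀)
    have := Real.exp_pos (-l * t₀)
    by_contra! hlt
    nlinarith
  have := heq t₀ ht₀ x₀ hx₀
  nlinarith [hl t₀ ht₀ x₀ hx₀]

/-- **Non-negativity of the temperature.** If `(u,θ)` is a smooth solution of the regularized
thermoelasticity system on `[0,T]` (any `ν ≥ 0`, including the thermoelasticity system itself
for `ν = 0`) with `θ(0,·) ≥ 0` on `[a,b]`, then `θ ≥ 0` on `[0,T] × [a,b]`. -/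
theorem temperature_nonneg (a b μ T ν : ℝ) (hab : a < b) (hμ : 0 < μ) (hT : 0 < T)
    (hν : 0 ≤ ν) (u θ : ℝ → ℝ → ℝ) (hsol : IsRegSolution a b μ T ν u θ)
    (hinit : ∀ x ∈ Icc a b, 0 ≤ θ 0 x) :
    ∀ t ∈ Icc (0:ℝ) T, ∀ x ∈ Icc a b, 0 ≤ θ t x := by
  obtain ⟨hu, hθ, -, heat, -, hbdry⟩ := hsol
  have hc : Continuous (Function.uncurry fun t x => μ * px (pt u) t x) :=
    continuous_const.mul (contDiff_uncurry_px (contDiff_uncurry_pt hu)).continuous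
  refine nonneg_of_heat_neumann hab hθ hc.continuousOn (fun t ht x hx => ?_) hbdry hinit
  linear_combination heat t ht x hx
end
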